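/- arXiv:2404.01634 — 2 statements merged into one kernel-verified Lean document; each statement's English description precedes it below -/
import Mathlib

section
/- Assume p > 2 and (H3). Let (r̄_n, μ̄_n, ū_n) be a sequence of solutions of (q1) with μ̄_n → ∞. Suppose Ū(r) is a continuous function defined for all small r > 0 such that for any ε ∈ (0,2) and L ∈ ℝ there exists r₀ ∈ (0,1) with U_{2−ε}(r) ≤ Ū(r) ≤ V_L(r) for all r ∈ (0, r₀). Then for any sequence (r_n) ⊂ (0, r̄_n] with μ̄_n^{−p}·log(1/r_n) → 0, one has, up to a subsequence, Z_{(0, r_n)}[ū_n − Ū] → ∞ as n → ∞. -/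
open Filter

/-- The comparison function `U_β(r) = (β log (1/r))^{1/p}`. -/
noncomputable def Ubeta (p β : ℝ) (r : ℝ) : ℝ := (β * Real.log (1 / r)) ^ (1 / p)

/-- The comparison function
`V_L(r) = {2 log(1/r) − (1 − (1−m)/p) log(2 log(1/r)) + L}^{1/p}`. -/
noncomputable def Vfun (p m L : ℝ) (r : ℝ) : ℝ :=
  (2 * Real.log (1 / r) -
    (1 - (1 - m) / p) * Real.log (2 * Real.log (1 / r)) + L) ^ (1 / p)

/-- `v` has at least `N` zeros on the set `I`. -/
def ZeroCountAtLeast (I : Set ℝ) (v : ℝ → ℝ) (N : ℕ) : Prop :=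
  ∃ S : Finset ℝ, ↑S ⊆ {x ∈ I | v x = 0} ∧ N ≤ S.card

/-- A positive solution of `u'' = -q` in the logarithmic variable `s = log (1/r)`, on `[σ, ∞)`,
with limit `μ` and flat at infinity; the source `q` is `c₀ u^m exp(u^p - 2s)` where `u ≥ τ₀`. -/
structure LogSol (p m c₀ τ₀ B σ μ : ℝ) (u v q : ℝ → ℝ) : Prop where
  hu : ∀ s, σ ≤ s → HasDerivAt u (v s) s
  hv : ∀ s, σ ≤ s → HasDerivAt v (-q s) s
  u_pos : ∀ s, σ ≤ s → 0 < u s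
  q_nonneg : ∀ s, σ ≤ s → 0 ≤ q s
  q_eq : ∀ s, σ ≤ s → τ₀ ≤ u s → q s = c₀ * u s ^ m * Real.exp (u s ^ p - 2 * s)
  q_le : ∀ s, σ ≤ s → u s ≤ τ₀ → q s ≤ B * Real.exp (-2 * s)
  v_lim : Tendsto v atTop (nhds 0)
  u_lim : Tendsto u atTop (nhds μ)

/-- The phase `w = u^p - 2s`. -/
noncomputable def phase (p : ℝ) (u : ℝ → ℝ) (s : ℝ) : ℝ := u s ^ p - 2 * s

/-- The derivative of `u^p` when `u' = v`. -/
noncomputable def powSlope (p : ℝ) (u v : ℝ → ℝ) (s : ℝ) : ℝ := p * u s ^ p * v s / u s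

/-- The normalized source `p u^(p-1) c₀ u^m exp(u^p - 2s)`. -/
noncomputable def source (p m c₀ : ℝ) (u : ℝ → ℝ) (s : ℝ) : ℝ :=
  c₀ * p * u s ^ m * u s ^ p / u s * Real.exp (u s ^ p - 2 * s)

/-- The approximately conserved energy of the phase. -/
noncomputable def energy (p m c₀ : ℝ) (u v : ℝ → ℝ) (s : ℝ) : ℝ :=
  (powSlope p u v s - 2) ^ 2 / 2 + source p m c₀ u s

lemma sub_le_mul_of_hasDerivAt_le {f f' : ℝ → ℝ} {a b C : ℝ} (hab : a ≤ b)
    (hd : ∀ x ∈ Set.Icc a b, HasDerivAt f (f' x) x) (hC : ∀ x ∈ Set.Ioo a b, f' x ≤ C) :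
    f b - f a ≤ C * (b - a) := by
  refine Convex.image_sub_le_mul_sub_of_deriv_le (convex_Icc a b)
    (fun x hx => (hd x hx).continuousAt.continuousWithinAt)
    (fun x hx => ?_) (fun x hx => ?_) a ⟨le_rfl, hab⟩ b ⟨hab, le_rfl⟩ hab
  · rw [interior_Icc] at hx
    exact (hd x ⟨hx.1.le, hx.2.le⟩).differentiableAt.differentiableWithinAt
  · rw [interior_Icc] at hx
    rw [(hd x ⟨hx.1.le, hx.2.le⟩).deriv]
    exact hC x hx

lemma mul_le_sub_of_le_hasDerivAt {f f' : ℝ → ℝ} {a b C : ℝ} (hab : a ≤ b)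
    (hd : ∀ x ∈ Set.Icc a b, HasDerivAt f (f' x) x) (hC : ∀ x ∈ Set.Ioo a b, C ≤ f' x) :
    C * (b - a) ≤ f b - f a := by
  have := sub_le_mul_of_hasDerivAt_le (f := fun x => -f x) (f' := fun x => -f' x) (C := -C) hab
    (fun x hx => (hd x hx).neg) (fun x hx => neg_le_neg (hC x hx))
  linarith

/-- A function that is nondecreasing on `[s, ∞)` lies below its limit. -/
lemma le_of_hasDerivAt_nonneg_of_tendsto {f f' : ℝ → ℝ} {s l : ℝ}
    (hd : ∀ x, s ≤ x → HasDerivAt f (f' x) x) (hf : ∀ x, s ≤ x → 0 ≤ f' x)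
    (hl : Tendsto f atTop (nhds l)) : f s ≤ l := by
  refine ge_of_tendsto hl ((eventually_ge_atTop s).mono fun x hx => ?_)
  have := mul_le_sub_of_le_hasDerivAt (C := 0) hx (fun y hy => hd y hy.1) (fun y hy => hf y hy.1.le)
  linarith

lemma source_pos {p m c₀ : ℝ} {u : ℝ → ℝ} {s : ℝ} (hp : 2 < p) (hc : 0 < c₀) (hu : 0 < u s) :
    0 < source p m c₀ u s := by
  unfold source; positivity

namespace LogSol

variable {p m c₀ τ₀ B σ μ : ℝ} {u v q : ℝ → ℝ}

lemma v_anti (h : LogSol p m c₀ τ₀ B σ μ u v q) {s t : ℝ} (hs : σ ≤ s) (hst : s ≤ t) :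
    v t ≤ v s := by
  have := sub_le_mul_of_hasDerivAt_le (C := 0) hst (fun x hx => h.hv x (hs.trans hx.1))
    (fun x hx => neg_nonpos.2 (h.q_nonneg x (hs.trans hx.1.le)))
  linarith

lemma v_nonneg (h : LogSol p m c₀ τ₀ B σ μ u v q) {s : ℝ} (hs : σ ≤ s) : 0 ≤ v s :=
  le_of_tendsto h.v_lim ((eventually_ge_atTop s).mono fun _ hx => h.v_anti hs hx)

lemma u_mono (h : LogSol p m c₀ τ₀ B σ μ u v q) {s t : ℝ} (hs : σ ≤ s) (hst : s ≤ t) :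
    u s ≤ u t := by
  have := mul_le_sub_of_le_hasDerivAt (C := 0) hst (fun x hx => h.hu x (hs.trans hx.1))
    (fun x hx => h.v_nonneg (hs.trans hx.1.le))
  linarith

lemma u_le (h : LogSol p m c₀ τ₀ B σ μ u v q) {s : ℝ} (hs : σ ≤ s) : u s ≤ μ :=
  ge_of_tendsto h.u_lim ((eventually_ge_atTop s).mono fun _ hx => h.u_mono hs hx)

lemma sub_le (h : LogSol p m c₀ τ₀ B σ μ u v q) {s t : ℝ} (hs : σ ≤ s) (hst : s ≤ t) :
    u t - u s ≤ v s * (t - s) :=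
  sub_le_mul_of_hasDerivAt_le hst (fun x hx => h.hu x (hs.trans hx.1))
    (fun _ hx => h.v_anti hs hx.1.le)

lemma mul_v_le (h : LogSol p m c₀ τ₀ B σ μ u v q) {s : ℝ} (hs : σ ≤ s) :
    (s - σ) * v s ≤ u s := by
  have := mul_le_sub_of_le_hasDerivAt (C := v s) hs (fun x hx => h.hu x hx.1)
    (fun x hx => h.v_anti hx.1.le hx.2.le)
  have := h.u_pos σ le_rfl
  linarith

lemma concave_le (h : LogSol p m c₀ τ₀ B σ μ u v q) {s t : ℝ} (hs : σ ≤ s) (hst : s ≤ t) :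
    (s - σ) * u t ≤ (t - σ) * u s := by
  have h1 := mul_le_mul_of_nonneg_left (h.sub_le hs hst) (sub_nonneg.2 hs)
  have h2 := mul_le_mul_of_nonneg_right (h.mul_v_le hs) (sub_nonneg.2 hst)
  linarith

lemma hasDerivAt_pow (h : LogSol p m c₀ τ₀ B σ μ u v q) (r : ℝ) {s : ℝ} (hs : σ ≤ s) :
    HasDerivAt (fun x => u x ^ r) (r * u s ^ r * v s / u s) s := by
  have hu := h.u_pos s hs
  convert (h.hu s hs).rpow_const (p := r) (Or.inl hu.ne') using 1
  rw [Real.rpow_sub_one hu.ne']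
  ring

lemma hasDerivAt_phase (h : LogSol p m c₀ τ₀ B σ μ u v q) {s : ℝ} (hs : σ ≤ s) :
    HasDerivAt (phase p u) (powSlope p u v s - 2) s := by
  have := (h.hasDerivAt_pow p hs).sub ((hasDerivAt_id s).const_mul 2)
  refine HasDerivAt.congr_deriv (f := phase p u) this ?_
  simp [powSlope]

lemma hasDerivAt_exp_phase (h : LogSol p m c₀ τ₀ B σ μ u v q) {s : ℝ} (hs : σ ≤ s) :
    HasDerivAt (fun x => Real.exp (u x ^ p - 2 * x))
      (Real.exp (u s ^ p - 2 * s) * (powSlope p u v s - 2)) s :=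
  (h.hasDerivAt_phase hs).exp

lemma hasDerivAt_powSlope (h : LogSol p m c₀ τ₀ B σ μ u v q) (hp : 2 < p) {s : ℝ} (hs : σ ≤ s)
    (hτ : τ₀ ≤ u s) :
    HasDerivAt (powSlope p u v)
      (-source p m c₀ u s + (p - 1) / p * powSlope p u v s ^ 2 / u s ^ p) s := by
  have hu := h.u_pos s hs
  have hX : 0 < u s ^ p := Real.rpow_pos_of_pos hu p
  have := (((h.hasDerivAt_pow p hs).const_mul p).mul (h.hv s hs)).div (h.hu s hs) hu.ne'
  rw [h.q_eq s hs hτ] at this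
  refine HasDerivAt.congr_deriv (f := powSlope p u v) this ?_
  simp only [powSlope, source, Pi.mul_apply]
  have : p ≠ 0 := by linarith
  field_simp
  ring

lemma hasDerivAt_source (h : LogSol p m c₀ τ₀ B σ μ u v q) (hp : 2 < p) {s : ℝ} (hs : σ ≤ s) :
    HasDerivAt (source p m c₀ u)
      (source p m c₀ u s * (powSlope p u v s - 2 +
        (m + p - 1) / p * powSlope p u v s / u s ^ p)) s := by
  have hu := h.u_pos s hs
  have hX : 0 < u s ^ p := Real.rpow_pos_of_pos hu p
  have := (((((h.hasDerivAt_pow m hs).const_mul (c₀ * p)).mul (h.hasDerivAt_pow p hs)).div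
    (h.hu s hs) hu.ne').mul (h.hasDerivAt_exp_phase hs))
  refine HasDerivAt.congr_deriv (f := source p m c₀ u) this ?_
  simp only [powSlope, source, Pi.mul_apply, Pi.div_apply]
  have : p ≠ 0 := by linarith
  field_simp
  ring

lemma hasDerivAt_energy (h : LogSol p m c₀ τ₀ B σ μ u v q) (hp : 2 < p) {s : ℝ} (hs : σ ≤ s)
    (hτ : τ₀ ≤ u s) :
    HasDerivAt (energy p m c₀ u v)
      (((p - 1) / p * (powSlope p u v s - 2) * powSlope p u v s ^ 2 +
        (m + p - 1) / p * source p m c₀ u s * powSlope p u v s) / u s ^ p) s := by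
  have := ((((h.hasDerivAt_powSlope hp hs hτ).sub_const 2).pow 2).div_const 2).add
    (h.hasDerivAt_source (m := m) (c₀ := c₀) hp hs)
  refine HasDerivAt.congr_deriv (f := energy p m c₀ u v) this ?_
  have hX : 0 < u s ^ p := Real.rpow_pos_of_pos (h.u_pos s hs) p
  have : p ≠ 0 := by linarith
  field_simp
  ring

lemma powSlope_nonneg (h : LogSol p m c₀ τ₀ B σ μ u v q) (hp : 2 < p) {s : ℝ} (hs : σ ≤ s) :
    0 ≤ powSlope p u v s := by
  have := h.u_pos s hs
  have := h.v_nonneg hs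
  unfold powSlope; positivity

/-- Pohozaev-type inequality. -/
lemma pohozaev (h : LogSol p m c₀ τ₀ B σ μ u v q) (hp : 2 < p) (hc : 0 < c₀) {ε A s : ℝ}
    (hA : 0 < A) (hεA : |m + 1 - p| ≤ 2 * ε * A) (hs : σ + A ≤ s) (hτ : τ₀ ≤ u s) :
    powSlope p u v s ^ 2 / 2 + source p m c₀ u s ≤ 2 * (1 + ε) * powSlope p u v s := by
  have hs' : σ ≤ s := by linarith
  have hus := h.u_pos s hs'
  have hXs : 0 < u s ^ p := Real.rpow_pos_of_pos hus p
  have hp0 : 0 < p := by linarith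
  set κ : ℝ := 2 * (1 + ε) * u s / (p * u s ^ p) with hκ
  have hε : 0 ≤ ε := by
    by_contra hcon
    push Not at hcon
    have := abs_nonneg (m + 1 - p)
    nlinarith
  let D : ℝ → ℝ := fun x => v x ^ 2 / 2 +
    c₀ / p * u x ^ (m + 1 - p) * Real.exp (u x ^ p - 2 * x) - κ * v x
  let D' : ℝ → ℝ := fun x => c₀ / p * u x ^ (m + 1 - p) * Real.exp (u x ^ p - 2 * x) *
    ((m + 1 - p) * v x / u x - 2 + κ * (p * u x ^ p / u x))
  have hrp : ∀ x, σ ≤ x → u x ^ (m + 1 - p) = u x ^ m * u x / u x ^ p := by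
    intro x hx
    rw [Real.rpow_sub (h.u_pos x hx), Real.rpow_add_one (h.u_pos x hx).ne']
  have hD : ∀ x, s ≤ x → HasDerivAt D (D' x) x := by
    intro x hx
    have hx' := hs'.trans hx
    have hu := h.u_pos x hx'
    have hX : 0 < u x ^ p := Real.rpow_pos_of_pos hu p
    have := (((h.hv x hx').pow 2).div_const 2).add ((((h.hasDerivAt_pow (m + 1 - p) hx').const_mul
      (c₀ / p)).mul (h.hasDerivAt_exp_phase hx'))) |>.sub ((h.hv x hx').const_mul κ)
    rw [h.q_eq x hx' (hτ.trans (h.u_mono hs' hx))] at this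
    refine HasDerivAt.congr_deriv (f := D) this ?_
    simp only [D', powSlope]
    rw [hrp x hx']
    field_simp
    ring
  have hD0 : ∀ x, s ≤ x → 0 ≤ D' x := by
    intro x hx
    have hx' := hs'.trans hx
    have hu := h.u_pos x hx'
    have hX : 0 < u x ^ p := Real.rpow_pos_of_pos hu p
    refine mul_nonneg (by positivity) ?_
    have h1 : 2 * (1 + ε) ≤ κ * (p * u x ^ p / u x) := by
      have h2 : u s ^ p / u s ≤ u x ^ p / u x := by
        rw [← Real.rpow_sub_one hus.ne', ← Real.rpow_sub_one hu.ne']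
        exact Real.rpow_le_rpow hus.le (h.u_mono hs' hx) (by linarith)
      have h3 : κ * (p * u x ^ p / u x) = 2 * (1 + ε) * ((u x ^ p / u x) / (u s ^ p / u s)) := by
        rw [hκ]; field_simp
      rw [h3]
      have h4 : 1 ≤ (u x ^ p / u x) / (u s ^ p / u s) := by
        rw [le_div_iff₀ (by positivity)]; linarith
      nlinarith
    have h2 : |(m + 1 - p) * v x / u x| ≤ 2 * ε := by
      have hv := h.v_nonneg hx'
      rw [abs_div, abs_mul, abs_of_nonneg hv, abs_of_pos hu, div_le_iff₀ hu]
      have h5 : A * v x ≤ u x :=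
        (mul_le_mul_of_nonneg_right (by linarith) hv).trans (h.mul_v_le hx')
      calc |m + 1 - p| * v x ≤ 2 * ε * A * v x := by gcongr
        _ = 2 * ε * (A * v x) := by ring
        _ ≤ 2 * ε * u x := by gcongr
    have := (abs_le.1 h2).1
    linarith
  have hμ : 0 < μ := hus.trans_le (h.u_le hs')
  have hlim : Tendsto D atTop (nhds 0) := by
    have e1 : Tendsto (fun x => u x ^ p - 2 * x) atTop atBot := by
      have := (h.u_lim.rpow_const (p := p) (Or.inl hμ.ne'))
      have h2 : Tendsto (fun x : ℝ => -(2 * x)) atTop atBot :=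
        tendsto_neg_atTop_atBot.comp (tendsto_id.const_mul_atTop (by norm_num))
      simpa [sub_eq_add_neg] using this.add_atBot h2
    have e2 := Real.tendsto_exp_atBot.comp e1
    have e3 := ((h.u_lim.rpow_const (p := m + 1 - p) (Or.inl hμ.ne')).const_mul (c₀ / p)).mul e2
    have e4 := (((h.v_lim.pow 2).div_const 2).add e3).sub (h.v_lim.const_mul κ)
    simpa [D] using e4
  have hfin := le_of_hasDerivAt_nonneg_of_tendsto hD hD0 hlim
  simp only [D, hrp s hs', hκ] at hfin
  have hmul := mul_nonpos_of_nonneg_of_nonpos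
    (by positivity : (0:ℝ) ≤ (p * u s ^ p / u s) ^ 2) hfin
  have hid : (p * u s ^ p / u s) ^ 2 * (v s ^ 2 / 2 + c₀ / p * (u s ^ m * u s / u s ^ p) *
      Real.exp (u s ^ p - 2 * s) - 2 * (1 + ε) * u s / (p * u s ^ p) * v s) =
      powSlope p u v s ^ 2 / 2 + source p m c₀ u s - 2 * (1 + ε) * powSlope p u v s := by
    unfold powSlope source
    field_simp
  linarith

end LogSol

/-- A priori bounds for a solution on `[a, b]`: `u ≥ τ₀`, `u^p ≥ K`, and the universal bounds on the
slope and the normalized source. -/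
def RegularOn (p m c₀ τ₀ σ K : ℝ) (u v : ℝ → ℝ) (a b : ℝ) : Prop :=
  ∀ s ∈ Set.Icc a b, σ ≤ s ∧ τ₀ ≤ u s ∧ K ≤ u s ^ p ∧ powSlope p u v s ≤ 5 ∧ source p m c₀ u s ≤ 3

/-- Lipschitz constant of the energy, up to the factor `1 / K`. -/
noncomputable def energyLip (p m : ℝ) : ℝ := 75 + 15 * |m + p - 1|

lemma energyLip_pos (p m : ℝ) : 0 < energyLip p m := by unfold energyLip; positivity

namespace LogSol

variable {p m c₀ τ₀ B σ μ : ℝ} {u v q : ℝ → ℝ}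

lemma abs_deriv_energy_le (h : LogSol p m c₀ τ₀ B σ μ u v q) (hp : 2 < p) (hc : 0 < c₀)
    {a b K s : ℝ} (hK : 0 < K) (hr : RegularOn p m c₀ τ₀ σ K u v a b) (hs : s ∈ Set.Icc a b) :
    |((p - 1) / p * (powSlope p u v s - 2) * powSlope p u v s ^ 2 +
        (m + p - 1) / p * source p m c₀ u s * powSlope p u v s) / u s ^ p| ≤
      energyLip p m / K := by
  obtain ⟨h1, -, h3, h4, h5⟩ := hr s hs
  have hψ := h.powSlope_nonneg hp h1
  have hG := source_pos (p := p) (m := m) hp hc (h.u_pos s h1)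
  have hp0 : 0 < p := by linarith
  rw [abs_div, abs_of_pos (hK.trans_le h3)]
  refine div_le_div₀ (energyLip_pos p m).le ?_ hK h3
  refine (abs_add_le _ _).trans (add_le_add ?_ ?_)
  · rw [abs_mul, abs_mul, abs_of_nonneg (sq_nonneg (powSlope p u v s))]
    have e1 : |(p - 1) / p| ≤ 1 := by
      rw [abs_of_nonneg (div_nonneg (by linarith) hp0.le), div_le_one hp0]; linarith
    have e2 : |powSlope p u v s - 2| ≤ 3 := abs_le.2 ⟨by linarith, by linarith⟩
    have e3 : powSlope p u v s ^ 2 ≤ 25 := by nlinarith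
    calc _ ≤ 1 * 3 * (25 : ℝ) := by gcongr
      _ = 75 := by norm_num
  · rw [abs_mul, abs_mul, abs_of_pos hG, abs_of_nonneg hψ, abs_div, abs_of_pos hp0]
    have e1 : |m + p - 1| / p ≤ |m + p - 1| := div_le_self (abs_nonneg _) (by linarith)
    calc _ ≤ |m + p - 1| * 3 * (5 : ℝ) := by gcongr
      _ = 15 * |m + p - 1| := by ring

lemma energy_sub_le (h : LogSol p m c₀ τ₀ B σ μ u v q) (hp : 2 < p) (hc : 0 < c₀)
    {a b K s : ℝ} (hK : 0 < K) (hr : RegularOn p m c₀ τ₀ σ K u v a b) (hs : s ∈ Set.Icc a b) :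
    energy p m c₀ u v b - energy p m c₀ u v s ≤ energyLip p m / K * (b - a) := by
  have hmem : ∀ x ∈ Set.Icc s b, x ∈ Set.Icc a b := fun x hx => ⟨hs.1.trans hx.1, hx.2⟩
  refine (sub_le_mul_of_hasDerivAt_le hs.2 (fun x hx => h.hasDerivAt_energy hp (hr x (hmem x hx)).1
    (hr x (hmem x hx)).2.1) (C := energyLip p m / K) fun x hx => (le_abs_self _).trans
    (h.abs_deriv_energy_le hp hc hK hr (hmem x ⟨hx.1.le, hx.2.le⟩))).trans ?_
  have := hs.1
  have := div_pos (energyLip_pos p m) hK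
  gcongr

lemma deriv_powSlope_le (h : LogSol p m c₀ τ₀ B σ μ u v q) (hp : 2 < p)
    {a b K s : ℝ} (hK : 0 < K) (hr : RegularOn p m c₀ τ₀ σ K u v a b) (hs : s ∈ Set.Icc a b) :
    (p - 1) / p * powSlope p u v s ^ 2 / u s ^ p ≤ 25 / K := by
  obtain ⟨h1, -, h3, h4, h5⟩ := hr s hs
  have hψ := h.powSlope_nonneg hp h1
  have hp0 : 0 < p := by linarith
  refine div_le_div₀ (by norm_num) ?_ hK h3
  have e1 : (p - 1) / p ≤ 1 := by rw [div_le_one hp0]; linarith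
  have e3 : powSlope p u v s ^ 2 ≤ 25 := by nlinarith
  calc _ ≤ 1 * (25 : ℝ) := by gcongr
    _ = 25 := by norm_num

/-- Going backwards from a strong peak of the phase, the phase decays linearly. -/
lemma phase_le_of_peak (h : LogSol p m c₀ τ₀ B σ μ u v q) (hp : 2 < p) (hc : 0 < c₀)
    {a b K c : ℝ} (hab : a ≤ b) (hK : 0 < K) (hr : RegularOn p m c₀ τ₀ σ K u v a b)
    (hpk : powSlope p u v b = 2) (hc' : 0 < c) (hG : c ≤ source p m c₀ u b)
    (h1 : energyLip p m / K * (b - a) ≤ c / 2) (h2 : 25 / K ≤ c / 4) :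
    phase p u a ≤ phase p u b + 2 - c / 6 * (b - a) := by
  have hE : ∀ s ∈ Set.Icc a b, c / 2 ≤ energy p m c₀ u v s := by
    intro s hs
    have e1 := h.energy_sub_le hp hc hK hr hs
    have e2 : energy p m c₀ u v b = source p m c₀ u b := by simp [energy, hpk]
    linarith
  have hbar : ∀ s ∈ Set.Icc a b, 2 ≤ powSlope p u v s := by
    have hmem : ∀ x ∈ Set.Icc (-b) (-a), -x ∈ Set.Icc a b :=
      fun x hx => ⟨by linarith [hx.2], by linarith [hx.1]⟩
    have hder : ∀ x ∈ Set.Icc (-b) (-a), HasDerivAt (fun x => -powSlope p u v (-x))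
        (-source p m c₀ u (-x) + (p - 1) / p * powSlope p u v (-x) ^ 2 / u (-x) ^ p) x := by
      intro x hx
      have := ((h.hasDerivAt_powSlope hp (hr _ (hmem x hx)).1 (hr _ (hmem x hx)).2.1).comp x
        (hasDerivAt_neg x)).neg
      refine HasDerivAt.congr_deriv (f := fun x => -powSlope p u v (-x)) this ?_
      ring
    have := image_le_of_deriv_right_lt_deriv_boundary (f := fun x => -powSlope p u v (-x))
      (B := fun _ => -2) (B' := fun _ => 0) (a := -b) (b := -a)
      (fun x hx => (hder x hx).continuousAt.continuousWithinAt)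
      (fun x hx => (hder x ⟨hx.1, hx.2.le⟩).hasDerivWithinAt)
      (by simp [hpk]) (fun x => hasDerivAt_const x _) (fun x hx hx2 => by
        have hx' := hmem x ⟨hx.1, hx.2.le⟩
        have e1 := hE _ hx'
        have e2 := h.deriv_powSlope_le hp hK hr hx'
        have e3 : powSlope p u v (-x) = 2 := by linarith
        have e4 : energy p m c₀ u v (-x) = source p m c₀ u (-x) := by simp [energy, e3]
        linarith)
    intro s hs
    have := @this (-s) ⟨by linarith [hs.2], by linarith [hs.1]⟩
    simpa using this
  have key := sub_le_mul_of_hasDerivAt_le (C := -(c / 4)) hab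
    (f := fun s => powSlope p u v s - 3 / 2 * phase p u s)
    (fun s hs => (h.hasDerivAt_powSlope hp (hr s hs).1 (hr s hs).2.1).sub
      ((h.hasDerivAt_phase (hr s hs).1).const_mul (3 / 2))) (fun s hs => by
        have hs' : s ∈ Set.Icc a b := ⟨hs.1.le, hs.2.le⟩
        have e1 := hE _ hs'
        have e2 := h.deriv_powSlope_le hp hK hr hs'
        have e3 := hbar s hs'
        have e4 := (hr s hs').2.2.2.1
        have e5 : (powSlope p u v s - 2) ^ 2 / 2 ≤ 3 / 2 * (powSlope p u v s - 2) := by nlinarith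
        unfold energy at e1
        linarith)
  have e4 := (hr a ⟨le_rfl, hab⟩).2.2.2.1
  simp only [hpk] at key
  linarith

/-- A fast descending phase reaches a strong peak when followed backwards, unless it becomes
too large. -/
lemma exists_peak_of_descending (h : LogSol p m c₀ τ₀ B σ μ u v q) (hp : 2 < p) (hc : 0 < c₀)
    {a t K b : ℝ} (hat : a ≤ t) (hK : 0 < K) (hr : RegularOn p m c₀ τ₀ σ K u v a t)
    (hb : 0 < b) (hpk : powSlope p u v t - 2 ≤ -b)
    (h1 : energyLip p m / K * (t - a) ≤ b ^ 2 / 4) (h2 : 25 / K ≤ b ^ 2 / 8)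
    (h3 : phase p u a < phase p u t + b ^ 2 / 8 * (t - a) - 2) :
    ∃ s, a ≤ s ∧ s < t ∧ powSlope p u v s = 2 ∧ b ^ 2 / 4 ≤ source p m c₀ u s := by
  have hE : ∀ s ∈ Set.Icc a t, b ^ 2 / 4 ≤ energy p m c₀ u v s := by
    intro s hs
    have e1 := h.energy_sub_le hp hc hK hr hs
    have e2 : b ^ 2 / 2 ≤ energy p m c₀ u v t := by
      unfold energy
      have := source_pos (p := p) (m := m) hp hc (h.u_pos t (hr t ⟨hat, le_rfl⟩).1)
      nlinarith
    linarith
  obtain ⟨x, hx, hx2⟩ : ∃ x ∈ Set.Icc a t, 2 ≤ powSlope p u v x := by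
    by_contra! hcon
    have key := sub_le_mul_of_hasDerivAt_le (C := -(b ^ 2 / 8)) hat
      (f := fun s => powSlope p u v s + phase p u s)
      (fun s hs => (h.hasDerivAt_powSlope hp (hr s hs).1 (hr s hs).2.1).add
        (h.hasDerivAt_phase (hr s hs).1)) (fun s hs => by
          have hs' : s ∈ Set.Icc a t := ⟨hs.1.le, hs.2.le⟩
          have e1 := hE _ hs'
          have e2 := h.deriv_powSlope_le hp hK hr hs'
          have e3 := hcon s hs'
          have e4 := h.powSlope_nonneg hp (hr s hs').1
          have e5 : (powSlope p u v s - 2) ^ 2 / 2 ≤ 2 - powSlope p u v s := by nlinarith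
          unfold energy at e1
          linarith)
    have e4 := h.powSlope_nonneg hp (hr t ⟨hat, le_rfl⟩).1
    have e3 := hcon a ⟨le_rfl, hat⟩
    linarith
  obtain ⟨s, hs, hs2⟩ := intermediate_value_Icc' hx.2 (f := powSlope p u v) (fun y hy =>
    (h.hasDerivAt_powSlope hp (hr y ⟨hx.1.trans hy.1, hy.2⟩).1
      (hr y ⟨hx.1.trans hy.1, hy.2⟩).2.1).continuousAt.continuousWithinAt)
    (show (2 : ℝ) ∈ Set.Icc _ _ from ⟨by linarith, hx2⟩)
  have hs' : s ∈ Set.Icc a t := ⟨hx.1.trans hs.1, hs.2⟩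
  refine ⟨s, hs'.1, lt_of_le_of_ne hs.2 ?_, hs2, ?_⟩
  · rintro rfl
    linarith
  · have := hE s hs'
    simpa [energy, hs2] using this

end LogSol

lemma abs_log_le_of_mem {k S y : ℝ} (hk : 0 < k) (hS : 1 ≤ S) (h1 : k * S ≤ y) (h2 : y ≤ 3 * S) :
    |Real.log y| ≤ Real.log S + (|Real.log k| + Real.log 3) := by
  have hS0 : 0 < S := by linarith
  have hy : 0 < y := (mul_pos hk hS0).trans_le h1
  have e1 := Real.log_le_log (mul_pos hk hS0) h1
  have e2 := Real.log_le_log hy h2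
  rw [Real.log_mul hk.ne' hS0.ne'] at e1
  rw [Real.log_mul (by norm_num) hS0.ne'] at e2
  have e3 := Real.log_nonneg hS
  have e4 := Real.log_nonneg (show (1:ℝ) ≤ 3 by norm_num)
  have e5 := neg_abs_le (Real.log k)
  have e6 := abs_nonneg (Real.log k)
  exact abs_le.2 ⟨by linarith, by linarith⟩

lemma rpow_mul_rpow_div_eq {p m x : ℝ} (hp : 2 < p) (hx : 0 < x) :
    x ^ m * x ^ p / x = (x ^ p) ^ ((m + p - 1) / p) := by
  rw [← Real.rpow_mul hx.le, ← Real.rpow_add hx, ← Real.rpow_sub_one hx.ne']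
  congr 1
  have : p ≠ 0 := by linarith
  field_simp

/-- The polynomial prefactor of the source is subexponential. -/
lemma eventually_prefactor_bounds {p m c₀ k ω : ℝ} (hp : 2 < p) (hc : 0 < c₀) (hk : 0 < k)
    (hω : 0 < ω) : ∀ᶠ S : ℝ in atTop, ∀ x : ℝ, 0 < x → k * S ≤ x ^ p → x ^ p ≤ 3 * S →
      Real.exp (-(ω * S)) ≤ c₀ * p * x ^ m * x ^ p / x ∧
        c₀ * p * x ^ m * x ^ p / x ≤ Real.exp (ω * S) := by
  set α := (m + p - 1) / p with hα
  have hlim : Tendsto (fun S : ℝ => (|α| * (Real.log S + (|Real.log k| + Real.log 3)) +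
      |Real.log (c₀ * p)|) / S) atTop (nhds 0) := by
    have h1 : Tendsto (fun S : ℝ => Real.log S / S) atTop (nhds 0) :=
      Real.isLittleO_log_id_atTop.tendsto_div_nhds_zero
    have h2 : ∀ C : ℝ, Tendsto (fun S : ℝ => C / S) atTop (nhds 0) :=
      fun C => tendsto_const_nhds.div_atTop tendsto_id
    have h3 := ((h1.const_mul |α|).add (h2 (|α| * (|Real.log k| + Real.log 3)))).add
      (h2 |Real.log (c₀ * p)|)
    simp only [mul_zero, add_zero] at h3
    refine h3.congr fun S => ?_
    ring
  filter_upwards [hlim.eventually (gt_mem_nhds hω), eventually_ge_atTop 1] with S h1 hS x hx h2 h3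
  have hS0 : 0 < S := by linarith
  rw [div_lt_iff₀ hS0] at h1
  have hX : 0 < x ^ p := Real.rpow_pos_of_pos hx p
  have hcp : 0 < c₀ * p := mul_pos hc (by linarith)
  have hrw : c₀ * p * x ^ m * x ^ p / x = Real.exp (Real.log (c₀ * p) + α * Real.log (x ^ p)) := by
    rw [Real.exp_add, Real.exp_log hcp, mul_comm α, Real.exp_mul, Real.exp_log hX,
      ← rpow_mul_rpow_div_eq hp hx]
    ring
  have h4 : |Real.log (c₀ * p) + α * Real.log (x ^ p)| ≤ ω * S := by
    refine (abs_add_le _ _).trans ?_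
    rw [abs_mul]
    have := mul_le_mul_of_nonneg_left (abs_log_le_of_mem hk hS h2 h3) (abs_nonneg α)
    linarith
  rw [hrw, Real.exp_le_exp, Real.exp_le_exp]
  exact abs_le.1 h4

lemma eventually_source_bounds {p m c₀ k ω : ℝ} (hp : 2 < p) (hc : 0 < c₀) (hk : 0 < k)
    (hω : 0 < ω) : ∀ᶠ S : ℝ in atTop, ∀ (u : ℝ → ℝ) (s : ℝ), 0 < u s → k * S ≤ u s ^ p →
      u s ^ p ≤ 3 * S →
      Real.exp (phase p u s - ω * S) ≤ source p m c₀ u s ∧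
        source p m c₀ u s ≤ Real.exp (phase p u s + ω * S) := by
  filter_upwards [eventually_prefactor_bounds (m := m) hp hc hk hω] with S hS u s hu h1 h2
  obtain ⟨h3, h4⟩ := hS (u s) hu h1 h2
  unfold phase source
  rw [sub_eq_neg_add, Real.exp_add, Real.exp_add, mul_comm (Real.exp (u s ^ p - 2 * s))]
  constructor <;> gcongr

/-- A bounded source keeps `u^p` below `3s`. -/
lemma eventually_rpow_le_of_source_le {p m c₀ : ℝ} (hp : 2 < p) (hc : 0 < c₀) :
    ∀ᶠ S : ℝ in atTop, ∀ u : ℝ → ℝ, 0 < u S → source p m c₀ u S ≤ 3 → u S ^ p ≤ 3 * S := by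
  obtain ⟨M, hM⟩ := eventually_atTop.1 (eventually_source_bounds (m := m) (k := 3) (ω := 1 / 2)
    hp hc (by norm_num) (by norm_num))
  filter_upwards [eventually_ge_atTop M, eventually_ge_atTop 6] with S h1 h2 u hu hG
  by_contra! hcon
  obtain ⟨h3, -⟩ := hM (u S ^ p / 3) (by linarith) u S hu (by linarith) (by linarith)
  have h4 := Real.add_one_le_exp (phase p u S - 1 / 2 * (u S ^ p / 3))
  unfold phase at h3 h4
  linarith

namespace LogSol

variable {p m c₀ τ₀ B σ μ : ℝ} {u v q : ℝ → ℝ}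

/-- Uniform a priori bounds away from the left end of the domain. -/
lemma exists_apriori_bounds (p m c₀ τ₀ B : ℝ) (hp : 2 < p) (hc : 0 < c₀) {d : ℝ} (hd : 0 < d)
    (hd1 : d ≤ 1) : ∃ A > 0, ∀ (σ μ : ℝ) (u v q : ℝ → ℝ), LogSol p m c₀ τ₀ B σ μ u v q →
      ∀ s, σ + A ≤ s → τ₀ ≤ u s → powSlope p u v s ≤ 4 + d / 4 ∧ source p m c₀ u s ≤ 3 := by
  refine ⟨|m + 1 - p| / (d / 8) + 1, by positivity, fun σ μ u v q h s hs hτ => ?_⟩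
  have hσ : σ ≤ s := by
    have : 0 ≤ |m + 1 - p| / (d / 8) := by positivity
    linarith
  have key := h.pohozaev hp hc (ε := d / 16) (A := |m + 1 - p| / (d / 8) + 1) (by positivity)
    (by field_simp; nlinarith) hs hτ
  have hψ := h.powSlope_nonneg hp hσ
  have hG := source_pos (p := p) (m := m) hp hc (h.u_pos s hσ)
  constructor
  · by_contra! hcon
    nlinarith
  · nlinarith [sq_nonneg (powSlope p u v s - 2 * (1 + d / 16))]

/-- After a descent the phase comes back, transversally, to nearly zero level. -/
lemma exists_descending (h : LogSol p m c₀ τ₀ B σ μ u v q) (hp : 2 < p)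
    {S s₁ K κ δ ε θ ω c₁ g : ℝ} (hσ : 0 ≤ σ) (hκ : 0 < κ) (hσκ : σ ≤ κ * S) (hS : 0 < S)
    (hs₁ : s₁ ≤ S) (hs₁' : 2 * κ * S ≤ s₁)
    (hr : RegularOn p m c₀ τ₀ σ K u v (2 * κ * S) s₁)
    (hψ : powSlope p u v s₁ ≤ 4 + ε) (hθ0 : 0 ≤ θ)
    (hθ : (4 + ε + δ) * S ≤ p * (1 - θ) * u s₁ ^ p) (h5 : 5 * κ * S ≤ θ ^ p * u s₁ ^ p)
    (hw : phase p u s₁ ≤ -(c₁ * S)) (hω : 0 < ω) (hωc : ω ≤ c₁ / 8) (hg0 : 0 ≤ g)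
    (hG : ∀ s ∈ Set.Icc (2 * κ * S) s₁, phase p u s ≤ -(ω * S) → source p m c₀ u s ≤ g)
    (hg1 : g * S ≤ δ * κ ^ (p - 1)) (hg2 : g * S ≤ c₁ / 8) :
    ∃ s ∈ Set.Icc (2 * κ * S) s₁, -(ω * S) ≤ phase p u s ∧ powSlope p u v s - 2 ≤ -(c₁ / 2) := by
  have hp0 : 0 < p := by linarith
  have hκS : 0 < κ * S := mul_pos hκ hS
  have hσs₁ : σ ≤ s₁ := by linarith
  have hu₁ := h.u_pos s₁ hσs₁
  have hX₁ : 0 < u s₁ ^ p := Real.rpow_pos_of_pos hu₁ p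
  have hne : ({x ∈ Set.Icc (2 * κ * S) s₁ | -(ω * S) ≤ phase p u x}).Nonempty := by
    by_contra hcon
    have hlow : ∀ x ∈ Set.Icc (2 * κ * S) s₁, phase p u x ≤ -(ω * S) := by
      intro x hx
      by_contra! hx2
      exact hcon ⟨x, hx, hx2.le⟩
    set Q : ℝ := g * u s₁ / (p * κ ^ (p - 1) * u s₁ ^ p) with hQ
    have hq : ∀ x ∈ Set.Icc (2 * κ * S) s₁, q x ≤ Q := by
      intro x hx
      obtain ⟨hx1, hx2, -⟩ := hr x hx
      have hu := h.u_pos x hx1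
      have hX : 0 < u x ^ p := Real.rpow_pos_of_pos hu p
      have hcmp : κ * u s₁ ≤ u x := by
        have e1 := h.concave_le hx1 hx.2
        have e2 : κ * S * u s₁ ≤ (x - σ) * u s₁ := by
          have := hx.1
          gcongr
          linarith
        have e3 : (s₁ - σ) * u x ≤ S * u x := by gcongr; linarith
        have e4 : S * (κ * u s₁) ≤ S * u x := by linarith
        exact le_of_mul_le_mul_left e4 hS
      have e1 : κ ^ (p - 1) * (u s₁ ^ p / u s₁) ≤ u x ^ p / u x := by
        rw [← Real.rpow_sub_one hu₁.ne', ← Real.rpow_sub_one hu.ne', ← Real.mul_rpow hκ.le hu₁.le]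
        exact Real.rpow_le_rpow (by positivity) hcmp (by linarith)
      have e2 : q x = source p m c₀ u x / (p * (u x ^ p / u x)) := by
        rw [h.q_eq x hx1 hx2]
        unfold source
        field_simp
      have e3 : Q = g / (p * (κ ^ (p - 1) * (u s₁ ^ p / u s₁))) := by
        rw [hQ]; field_simp
      rw [e2, e3]
      have := hG x hx (hlow x hx)
      have : 0 < κ ^ (p - 1) := Real.rpow_pos_of_pos hκ _
      gcongr
    have hκp : 0 < κ ^ (p - 1) := Real.rpow_pos_of_pos hκ _
    have hQ0 : 0 ≤ Q := by positivity
    have hv : ∀ x ∈ Set.Icc (2 * κ * S) s₁, v x ≤ v s₁ + Q * S := by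
      intro x hx
      have := mul_le_sub_of_le_hasDerivAt (C := -Q) hx.2
        (fun y hy => h.hv y (hr y ⟨hx.1.trans hy.1, hy.2⟩).1)
        (fun y hy => neg_le_neg (hq y ⟨hx.1.trans hy.1.le, hy.2.le⟩))
      have : Q * (s₁ - x) ≤ Q * S := by
        have := hx.1
        gcongr
        linarith
      linarith
    have hu2 := sub_le_mul_of_hasDerivAt_le (C := v s₁ + Q * S) hs₁'
      (fun y hy => h.hu y (hr y hy).1) (fun y hy => hv y ⟨hy.1.le, hy.2.le⟩)
    have hV : (v s₁ + Q * S) * S ≤ (1 - θ) * u s₁ := by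
      have e1 : v s₁ = powSlope p u v s₁ * (u s₁ / (p * u s₁ ^ p)) := by
        unfold powSlope; field_simp
      have e2 : Q * S ≤ δ * (u s₁ / (p * u s₁ ^ p)) := by
        have : Q * S = g * S * (u s₁ / (p * κ ^ (p - 1) * u s₁ ^ p)) := by rw [hQ]; ring
        rw [this]
        calc _ ≤ δ * κ ^ (p - 1) * (u s₁ / (p * κ ^ (p - 1) * u s₁ ^ p)) := by gcongr
          _ = _ := by field_simp
      have e3 : v s₁ + Q * S ≤ (4 + ε + δ) * (u s₁ / (p * u s₁ ^ p)) := by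
        rw [e1]
        have : powSlope p u v s₁ * (u s₁ / (p * u s₁ ^ p)) ≤
          (4 + ε) * (u s₁ / (p * u s₁ ^ p)) := by gcongr
        linarith
      calc (v s₁ + Q * S) * S ≤ (4 + ε + δ) * (u s₁ / (p * u s₁ ^ p)) * S := by gcongr
        _ = (4 + ε + δ) * S * (u s₁ / (p * u s₁ ^ p)) := by ring
        _ ≤ p * (1 - θ) * u s₁ ^ p * (u s₁ / (p * u s₁ ^ p)) := by gcongr
        _ = (1 - θ) * u s₁ := by field_simp
    have hmem : 2 * κ * S ∈ Set.Icc (2 * κ * S) s₁ := ⟨le_rfl, hs₁'⟩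
    have hθu : θ * u s₁ ≤ u (2 * κ * S) := by
      have : (v s₁ + Q * S) * (s₁ - 2 * κ * S) ≤ (v s₁ + Q * S) * S := by
        have := h.v_nonneg hσs₁
        gcongr
        linarith
      linarith
    have hpw : θ ^ p * u s₁ ^ p ≤ u (2 * κ * S) ^ p := by
      rw [← Real.mul_rpow hθ0 hu₁.le]
      exact Real.rpow_le_rpow (by positivity) hθu hp0.le
    have := hlow _ hmem
    unfold phase at this
    have := mul_pos hω hS
    linarith
  have hcont : ContinuousOn (phase p u) (Set.Icc (2 * κ * S) s₁) := fun x hx =>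
    (h.hasDerivAt_phase (hr x hx).1).continuousAt.continuousWithinAt
  have hcpt : IsCompact {x ∈ Set.Icc (2 * κ * S) s₁ | -(ω * S) ≤ phase p u x} :=
    isCompact_Icc.of_isClosed_subset
      (hcont.preimage_isClosed_of_isClosed isClosed_Icc isClosed_Ici) (fun x hx => hx.1)
  obtain ⟨s, ⟨hs, hsw⟩, hsmax⟩ := hcpt.exists_isGreatest hne
  refine ⟨s, hs, hsw, ?_⟩
  by_contra! hcon
  have hsub : ∀ x ∈ Set.Icc s s₁, x ∈ Set.Icc (2 * κ * S) s₁ := fun x hx => ⟨hs.1.trans hx.1, hx.2⟩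
  have hslope : ∀ x ∈ Set.Ioo s s₁, -(5 * c₁ / 8) ≤ powSlope p u v x - 2 := by
    intro x hx
    have := mul_le_sub_of_le_hasDerivAt (C := -g) hx.1.le (f := powSlope p u v)
      (fun y hy => h.hasDerivAt_powSlope hp (hr y (hsub y ⟨hy.1, hy.2.trans hx.2.le⟩)).1
        (hr y (hsub y ⟨hy.1, hy.2.trans hx.2.le⟩)).2.1) (fun y hy => by
          have hy' := hsub y ⟨hy.1.le, hy.2.le.trans hx.2.le⟩
          have e1 : phase p u y ≤ -(ω * S) := by
            by_contra! hy2
            exact absurd (hsmax ⟨hy', hy2.le⟩) (not_le.2 hy.1)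
          have e2 := hG y hy' e1
          have e3 : 0 ≤ (p - 1) / p * powSlope p u v y ^ 2 / u y ^ p := by
            have := Real.rpow_pos_of_pos (h.u_pos y (hr y hy').1) p
            have : 0 ≤ p - 1 := by linarith
            positivity
          linarith)
    have : g * (x - s) ≤ g * S := by
      have := hs.1
      have := hx.2
      gcongr
      linarith
    linarith
  have := mul_le_sub_of_le_hasDerivAt hs.2
    (fun y hy => h.hasDerivAt_phase (p := p) (hr y (hsub y hy)).1) hslope
  have hc₁ : 0 < c₁ := by linarith
  have : 5 * c₁ / 8 * (s₁ - s) ≤ 5 * c₁ / 8 * S := by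
    have := hs.1
    gcongr
    linarith
  have := mul_le_mul_of_nonneg_right hωc hS.le
  have := mul_pos hc₁ hS
  linarith

end LogSol

lemma eventually_mul_exp_neg_le {ω γ : ℝ} (hω : 0 < ω) (hγ : 0 < γ) :
    ∀ᶠ S : ℝ in atTop, Real.exp (-(ω * S)) * S ≤ γ := by
  have := (tendsto_rpow_mul_exp_neg_mul_atTop_nhds_zero 1 ω hω).eventually (ge_mem_nhds hγ)
  filter_upwards [this] with S hS
  rw [Real.rpow_one, neg_mul] at hS
  linarith

lemma eventually_le_mul_self {ω : ℝ} (hω : 0 < ω) (C : ℝ) : ∀ᶠ S : ℝ in atTop, C ≤ ω * S :=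
  (tendsto_id.const_mul_atTop hω).eventually_ge_atTop C

namespace LogSol

variable {p m c₀ τ₀ B σ μ : ℝ} {u v q : ℝ → ℝ}

set_option maxHeartbeats 2000000 in
/-- The oscillation step: a strong peak of the phase is preceded by a deep descent, which is itself
preceded by another strong peak. -/
lemma exists_next_peak (p m c₀ τ₀ B : ℝ) (hp : 2 < p) (hc₀ : 0 < c₀) (hτ₀ : 0 < τ₀) {c : ℝ}
    (hc : 0 < c) (hc1 : c ≤ 1) :
    ∃ c' κ c₁ : ℝ, 0 < c' ∧ c' ≤ 1 ∧ 0 < κ ∧ κ < 1 ∧ 0 < c₁ ∧ c₁ < 2 ∧ ∀ᶠ S : ℝ in atTop,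
      ∀ (σ μ : ℝ) (u v q : ℝ → ℝ), LogSol p m c₀ τ₀ B σ μ u v q → 0 ≤ σ → σ ≤ κ / 2 * S →
        S ≤ u S ^ p → powSlope p u v S = 2 → c ≤ source p m c₀ u S →
        ∃ s₁ s', κ * S ≤ s' ∧ s' < s₁ ∧ s₁ < S ∧ phase p u s₁ ≤ -(c₁ * S) ∧
          powSlope p u v s' = 2 ∧ c' ≤ source p m c₀ u s' ∧ s' ≤ u s' ^ p := by
  have hp0 : 0 < p := by linarith
  obtain ⟨d, hd0, hd1, hdp⟩ : ∃ d : ℝ, 0 < d ∧ d ≤ 1 ∧ 2 + d ≤ p :=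
    ⟨min 1 (p - 2), lt_min one_pos (by linarith), min_le_left _ _, by
      linarith [min_le_right 1 (p - 2)]⟩
  obtain ⟨A, hA, hbd⟩ := exists_apriori_bounds p m c₀ τ₀ B hp hc₀ hd0 hd1
  set θ : ℝ := d / 16 with hθ
  have hθ0 : 0 < θ := by positivity
  have hθp : θ ^ p ≤ 1 := Real.rpow_le_one hθ0.le (by linarith) hp0.le
  set κ : ℝ := θ ^ p / 5 with hκ
  have hκ0 : 0 < κ := by positivity
  have hκ5 : κ ≤ 1 / 5 := by rw [hκ]; linarith
  set k : ℝ := (κ / 2) ^ p with hk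
  have hk0 : 0 < k := by positivity
  have hk1 : k ≤ 1 := Real.rpow_le_one (by positivity) (by linarith) hp0.le
  have hCE := energyLip_pos p m
  set CE := energyLip p m
  obtain ⟨η, hη0, hηd, hηc⟩ : ∃ η : ℝ, 0 < η ∧ η ≤ d / 80 ∧ η ≤ c * k / (2 * CE) :=
    ⟨min (d / 80) (c * k / (2 * CE)), lt_min (by positivity) (by positivity), min_le_left _ _,
      min_le_right _ _⟩
  set c₁ : ℝ := c * η / 12 with hc₁
  have hc₁0 : 0 < c₁ := by positivity
  have hc₁1 : c₁ ≤ 1 := by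
    have : c * η ≤ 1 * 1 := by gcongr; linarith
    linarith
  set b : ℝ := c₁ / 2 with hb
  have hb0 : 0 < b := by positivity
  obtain ⟨η', hη'0, hη'κ, hη'b⟩ : ∃ η' : ℝ, 0 < η' ∧ η' ≤ κ ∧ η' ≤ b ^ 2 * k / (4 * CE) :=
    ⟨min κ (b ^ 2 * k / (4 * CE)), lt_min (by positivity) (by positivity), min_le_left _ _,
      min_le_right _ _⟩
  obtain ⟨ω, hω0, hω1, hω2, hω3, hω4⟩ : ∃ ω : ℝ, 0 < ω ∧ ω ≤ c₁ / 16 ∧ ω ≤ κ / 8 ∧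
      ω ≤ b ^ 2 * η' / 64 ∧ ω ≤ d / 64 :=
    ⟨min (min (c₁ / 16) (κ / 8)) (min (b ^ 2 * η' / 64) (d / 64)), by positivity,
      (min_le_left _ _).trans (min_le_left _ _), (min_le_left _ _).trans (min_le_right _ _),
      (min_le_right _ _).trans (min_le_left _ _), (min_le_right _ _).trans (min_le_right _ _)⟩
  refine ⟨b ^ 2 / 4, κ, c₁, by positivity, by nlinarith, hκ0, by linarith, hc₁0, by linarith, ?_⟩
  have hbη : 0 < b ^ 2 * η' / 16 := by positivity
  filter_upwards [eventually_gt_atTop 0, eventually_source_bounds (m := m) hp hc₀ hk0 hω0,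
    eventually_rpow_le_of_source_le (m := m) hp hc₀,
    eventually_mul_exp_neg_le hω0 (show 0 < d / 4 * κ ^ (p - 1) by positivity),
    eventually_mul_exp_neg_le hω0 (show 0 < c₁ / 8 by positivity),
    eventually_le_mul_self hω0 (-Real.log c), eventually_le_mul_self hω0 (-Real.log (b ^ 2 / 4)),
    eventually_le_mul_self hω0 (Real.log 3), eventually_le_mul_self hc₁0 8,
    eventually_gt_atTop (3 / (b ^ 2 * η' / 16)), eventually_le_mul_self (half_pos hκ0) A,
    eventually_le_mul_self hk0 (τ₀ ^ p),
    eventually_le_mul_self hk0 (25 / (c / 4)), eventually_le_mul_self hk0 (25 / (b ^ 2 / 8))]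
    with S hS hsrc h3S hg1 hg2 hlogc hlogb hlog3 hc₁S hbηS hAS hτS hKc hKb
  intro σ μ u v q h hσ hσκ hXS hψS hGS
  have hkS : 0 < k * S := by positivity
  have hκS : 0 < κ * S := by positivity
  have hσκ' : σ ≤ κ * S := by linarith
  have hσS : σ ≤ S := by nlinarith
  have huS := h.u_pos S hσS
  have hτle : ∀ s, σ ≤ s → k * S ≤ u s ^ p → τ₀ ≤ u s := fun s hs hX =>
    (Real.rpow_le_rpow_iff hτ₀.le (h.u_pos s hs).le hp0).1 (hτS.trans hX)
  have hlow : ∀ s ∈ Set.Icc (κ * S) S, k * S ≤ u s ^ p := by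
    intro s hs
    have hσs : σ ≤ s := by linarith [hs.1]
    have e1 := h.concave_le hσs hs.2
    have e2 : κ / 2 * S * u S ≤ (s - σ) * u S := by
      have := hs.1
      gcongr
      linarith
    have e3 : (S - σ) * u s ≤ S * u s := by
      have := (h.u_pos s hσs).le
      gcongr
      linarith
    have e4 : κ / 2 * u S ≤ u s := by
      refine le_of_mul_le_mul_left ?_ hS
      linarith
    calc k * S ≤ k * u S ^ p := by gcongr
      _ = (κ / 2 * u S) ^ p := by rw [hk, Real.mul_rpow (by positivity) huS.le]
      _ ≤ u s ^ p := Real.rpow_le_rpow (by positivity) e4 hp0.le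
  have happ : ∀ s ∈ Set.Icc (κ * S) S, powSlope p u v s ≤ 4 + d / 4 ∧ source p m c₀ u s ≤ 3 := by
    intro s hs
    have hσs : σ ≤ s := by linarith [hs.1]
    exact hbd σ μ u v q h s (by linarith [hs.1]) (hτle s hσs (hlow s hs))
  have hSmem : S ∈ Set.Icc (κ * S) S := ⟨by nlinarith, le_rfl⟩
  have hup : ∀ s ∈ Set.Icc (κ * S) S, u s ^ p ≤ 3 * S := by
    intro s hs
    have hσs : σ ≤ s := by linarith [hs.1]
    exact (Real.rpow_le_rpow (h.u_pos s hσs).le (h.u_mono hσs hs.2) hp0.le).trans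
      (h3S u huS (happ S hSmem).2)
  have hreg : ∀ a b', κ * S ≤ a → b' ≤ S → RegularOn p m c₀ τ₀ σ (k * S) u v a b' := by
    intro a b' ha hb' s hs
    have hs' : s ∈ Set.Icc (κ * S) S := ⟨ha.trans hs.1, hs.2.trans hb'⟩
    have hσs : σ ≤ s := by linarith [hs'.1]
    exact ⟨hσs, hτle s hσs (hlow s hs'), hlow s hs', by linarith [(happ s hs').1], (happ s hs').2⟩
  have hbounds : ∀ s ∈ Set.Icc (κ * S) S, Real.exp (phase p u s - ω * S) ≤ source p m c₀ u s ∧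
      source p m c₀ u s ≤ Real.exp (phase p u s + ω * S) := by
    intro s hs
    exact hsrc u s (h.u_pos s (by linarith [hs.1])) (hlow s hs) (hup s hs)
  have hphase_le : ∀ s ∈ Set.Icc (κ * S) S, phase p u s ≤ 2 * ω * S := by
    intro s hs
    have := (hbounds s hs).1.trans (happ s hs).2
    rw [← Real.le_log_iff_exp_le (by norm_num)] at this
    linarith
  have hphase_ge : ∀ s ∈ Set.Icc (κ * S) S, ∀ c', 0 < c' → c' ≤ source p m c₀ u s →
      -Real.log c' ≤ ω * S → -(2 * ω * S) ≤ phase p u s := by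
    intro s hs c' hc' hle hlog
    have := hle.trans (hbounds s hs).2
    rw [← Real.log_le_iff_le_exp hc'] at this
    linarith
  set s₁ : ℝ := S - η * S with hs₁
  have hηS : 0 < η * S := by positivity
  have hηS' : η * S ≤ d / 80 * S := by gcongr
  have hdS : d * S ≤ 1 * S := by gcongr
  have hdS0 : 0 < d * S := by positivity
  have hκS5 : κ * S ≤ 1 / 5 * S := by gcongr
  have hs₁mem : s₁ ∈ Set.Icc (κ * S) S := ⟨by linarith, by linarith⟩
  have hpeak := h.phase_le_of_peak hp hc₀ hs₁mem.2 hkS (hreg s₁ S hs₁mem.1 le_rfl) hψS hc hGS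
    (by
      have : CE / (k * S) * (S - s₁) = CE / k * η := by rw [hs₁]; field_simp; ring
      rw [this]
      calc CE / k * η ≤ CE / k * (c * k / (2 * CE)) := by gcongr
        _ = c / 2 := by field_simp)
    (by rw [div_le_iff₀ hkS]; rw [div_le_iff₀ (by positivity)] at hKc; linarith)
  have hωS : ω * S ≤ c₁ / 16 * S := by gcongr
  have hw₁ : phase p u s₁ ≤ -(c₁ * S) := by
    have e1 := hphase_le S hSmem
    have e2 : c / 6 * (S - s₁) = 2 * (c₁ * S) := by rw [hs₁, hc₁]; ring
    linarith
  have hX₁ : (2 - d / 8) * S ≤ u s₁ ^ p := by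
    have e1 := sub_le_mul_of_hasDerivAt_le (C := 5) hs₁mem.2
      (fun y hy => h.hasDerivAt_pow p (s := y) (by linarith [hy.1, hs₁mem.1]))
      (fun y hy => (hreg s₁ S hs₁mem.1 le_rfl y ⟨hy.1.le, hy.2.le⟩).2.2.2.1)
    have e2 := hphase_ge S hSmem c hc hGS hlogc
    unfold phase at e2
    have e3 : ω * S ≤ d / 64 * S := by gcongr
    linarith
  have hX₁S : S ≤ u s₁ ^ p := by linarith
  obtain ⟨s₃, hs₃, hw₃, hψ₃⟩ := h.exists_descending hp (S := S) (s₁ := s₁) (κ := κ) (ε := d / 4)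
    (δ := d / 4) (θ := θ) (ω := 2 * ω) (c₁ := c₁) (g := Real.exp (-(ω * S))) hσ hκ0 hσκ' hS
    hs₁mem.2 (by linarith) (hreg _ _ (by linarith) hs₁mem.2) (happ s₁ hs₁mem).1 hθ0.le
    (by
      have e1 : (4 + d / 4 + d / 4) ≤ (2 + d) * (1 - θ) * (2 - d / 8) := by
        rw [hθ]; nlinarith [mul_nonneg hd0.le (sub_nonneg.2 hd1), pow_pos hd0 3]
      calc (4 + d / 4 + d / 4) * S ≤ (2 + d) * (1 - θ) * (2 - d / 8) * S := by gcongr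
        _ = (2 + d) * (1 - θ) * ((2 - d / 8) * S) := by ring
        _ ≤ p * (1 - θ) * u s₁ ^ p := by
          have : 0 ≤ 1 - θ := by linarith
          gcongr
          nlinarith)
    (by
      calc 5 * κ * S = θ ^ p * S := by rw [hκ]; ring
        _ ≤ θ ^ p * u s₁ ^ p := by gcongr)
    hw₁ (by positivity) (by linarith) (Real.exp_pos _).le
    (fun s hs hws => (hbounds s ⟨by linarith [hs.1], hs.2.trans hs₁mem.2⟩).2.trans
      (Real.exp_le_exp.2 (by linarith))) hg1 hg2
  have hη'S : 0 < η' * S := by positivity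
  have hηκS : η' * S ≤ κ * S := by gcongr
  have ha : κ * S ≤ s₃ - η' * S := by linarith [hs₃.1]
  have hs₃S : s₃ ≤ S := hs₃.2.trans hs₁mem.2
  obtain ⟨s', hs'a, hs's, hψ', hG'⟩ := h.exists_peak_of_descending hp hc₀
    (a := s₃ - η' * S) (t := s₃) (b := b) (by linarith) hkS (hreg _ _ ha hs₃S) hb0 hψ₃
    (by
      have : CE / (k * S) * (s₃ - (s₃ - η' * S)) = CE / k * η' := by field_simp; ring
      rw [this]
      calc CE / k * η' ≤ CE / k * (b ^ 2 * k / (4 * CE)) := by gcongr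
        _ = b ^ 2 / 4 := by field_simp)
    (by rw [div_le_iff₀ hkS]; rw [div_le_iff₀ (by positivity)] at hKb; linarith)
    (by
      have e1 := hphase_le (s₃ - η' * S) ⟨ha, by linarith⟩
      have e2 : ω * S ≤ b ^ 2 * η' / 64 * S := by gcongr
      rw [div_lt_iff₀ hbη] at hbηS
      have e3 : b ^ 2 / 8 * (s₃ - (s₃ - η' * S)) = b ^ 2 * η' / 8 * S := by ring
      rw [e3]
      linarith)
  have hs'mem : s' ∈ Set.Icc (κ * S) S := ⟨ha.trans hs'a, by linarith⟩
  refine ⟨s₁, s', hs'mem.1, by linarith [hs₃.2], by linarith, hw₁, hψ', hG', ?_⟩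
  have e1 := hphase_ge s' hs'mem _ (by positivity) hG' hlogb
  have e2 : ω * S ≤ κ / 8 * S := by gcongr
  have e3 := hs'mem.1
  unfold phase at e1
  linarith

end LogSol

lemma hasDerivAt_exp_neg_two_mul (x : ℝ) :
    HasDerivAt (fun x : ℝ => Real.exp (-2 * x)) (-2 * Real.exp (-2 * x)) x := by
  have := ((hasDerivAt_id x).const_mul (-2)).exp
  refine HasDerivAt.congr_deriv (f := fun x : ℝ => Real.exp (-2 * x)) this ?_
  simp; ring

lemma tendsto_exp_neg_two_mul : Tendsto (fun x : ℝ => Real.exp (-2 * x)) atTop (nhds 0) :=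
  Real.tendsto_exp_atBot.comp (tendsto_id.const_mul_atTop_of_neg (by norm_num))

namespace LogSol

variable {p m c₀ τ₀ B σ μ : ℝ} {u v q : ℝ → ℝ}

/-- Exponential convergence at infinity. -/
lemma tail_bounds (h : LogSol p m c₀ τ₀ B σ μ u v q) {Q s : ℝ} (hs : σ ≤ s)
    (hq : ∀ x, s ≤ x → q x ≤ Q * Real.exp (-2 * x)) :
    v s ≤ Q / 2 * Real.exp (-2 * s) ∧ μ - u s ≤ Q / 4 * Real.exp (-2 * s) := by
  have h1 : ∀ x, s ≤ x → v x ≤ Q / 2 * Real.exp (-2 * x) := by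
    intro x hx
    have := le_of_hasDerivAt_nonneg_of_tendsto (s := x) (l := 0)
      (f := fun y => v y - Q / 2 * Real.exp (-2 * y))
      (fun y hy => (h.hv y (by linarith)).sub ((hasDerivAt_exp_neg_two_mul y).const_mul _))
      (fun y hy => by linarith [hq y (hx.trans hy)])
      (by simpa using h.v_lim.sub (tendsto_exp_neg_two_mul.const_mul (Q / 2)))
    linarith
  refine ⟨h1 s le_rfl, ?_⟩
  have := le_of_hasDerivAt_nonneg_of_tendsto (s := s) (l := -μ)
    (f := fun y => -u y - Q / 4 * Real.exp (-2 * y))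
    (fun y hy => (h.hu y (hs.trans hy)).neg.sub ((hasDerivAt_exp_neg_two_mul y).const_mul _))
    (fun y hy => by linarith [h1 y hy])
    (by simpa using h.u_lim.neg.sub (tendsto_exp_neg_two_mul.const_mul (Q / 4)))
  linarith

lemma source_tail_le (h : LogSol p m c₀ τ₀ B σ μ u v q) (hp : 2 < p) (hc₀ : 0 < c₀) (hτ₀ : 0 < τ₀)
    (hB : 0 ≤ B) {x : ℝ} (hx : σ ≤ x) :
    q x ≤ (B + c₀ * (τ₀ ^ m + μ ^ m) * Real.exp (μ ^ p)) * Real.exp (-2 * x) := by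
  have hu := h.u_pos x hx
  have huμ := h.u_le hx
  have hμ : 0 < μ := hu.trans_le huμ
  rcases le_total (u x) τ₀ with hle | hle
  · refine (h.q_le x hx hle).trans ?_
    gcongr
    have : 0 ≤ c₀ * (τ₀ ^ m + μ ^ m) * Real.exp (μ ^ p) := by positivity
    linarith
  · rw [h.q_eq x hx hle, sub_eq_add_neg, Real.exp_add, ← mul_assoc,
      show -(2 * x) = -2 * x by ring]
    gcongr
    have e1 : u x ^ m ≤ τ₀ ^ m + μ ^ m := by
      have t1 : 0 < τ₀ ^ m := Real.rpow_pos_of_pos hτ₀ m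
      have t2 : 0 < μ ^ m := Real.rpow_pos_of_pos hμ m
      rcases le_total 0 m with hm | hm
      · have := Real.rpow_le_rpow hu.le huμ hm
        linarith
      · have := Real.rpow_le_rpow_of_nonpos hτ₀ hle hm
        linarith
    have e2 : Real.exp (u x ^ p) ≤ Real.exp (μ ^ p) :=
      Real.exp_le_exp.2 (Real.rpow_le_rpow hu.le huμ (by linarith))
    have e3 : c₀ * u x ^ m * Real.exp (u x ^ p) ≤
        c₀ * (τ₀ ^ m + μ ^ m) * Real.exp (μ ^ p) := by gcongr
    linarith

set_option maxHeartbeats 1000000 in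
/-- The first peak of the phase. -/
lemma exists_first_peak (p m c₀ τ₀ B : ℝ) (hp : 2 < p) (hc₀ : 0 < c₀) (hτ₀ : 0 < τ₀)
    (hB : 0 ≤ B) :
    ∀ᶠ S : ℝ in atTop, ∀ (σ μ : ℝ) (u v q : ℝ → ℝ), LogSol p m c₀ τ₀ B σ μ u v q → 0 < μ →
      μ ^ p = S → 0 ≤ σ → σ ≤ S / 8 →
        ∃ s, S / 4 ≤ s ∧ powSlope p u v s = 2 ∧ 1 / 4 ≤ source p m c₀ u s ∧ s ≤ u s ^ p := by
  have hp0 : 0 < p := by linarith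
  obtain ⟨A, hA, hbd⟩ := exists_apriori_bounds p m c₀ τ₀ B hp hc₀ one_pos le_rfl
  set k : ℝ := (1 / 8) ^ p with hk
  have hk0 : 0 < k := by positivity
  have hk1 : k ≤ 1 := Real.rpow_le_one (by norm_num) (by norm_num) hp0.le
  have hCE := energyLip_pos p m
  set CE := energyLip p m
  obtain ⟨η, hη0, hη8, hηC⟩ : ∃ η : ℝ, 0 < η ∧ η ≤ 1 / 8 ∧ η ≤ k / (4 * CE) :=
    ⟨min (1 / 8) (k / (4 * CE)), by positivity, min_le_left _ _, min_le_right _ _⟩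
  set g : ℝ := η / 100 with hg
  have hg0 : 0 < g := by positivity
  have htail : ∀ᶠ S : ℝ in atTop,
      S * ((B + c₀ * (τ₀ ^ m + S ^ (m / p))) * Real.exp (-(2 * g * S))) ≤ g / p := by
    have e1 := tendsto_rpow_mul_exp_neg_mul_atTop_nhds_zero 1 (2 * g) (by positivity)
    have e2 := tendsto_rpow_mul_exp_neg_mul_atTop_nhds_zero (1 + m / p) (2 * g) (by positivity)
    have e3 := (e1.const_mul (B + c₀ * τ₀ ^ m)).add (e2.const_mul c₀)
    simp only [mul_zero, add_zero] at e3
    filter_upwards [e3.eventually (ge_mem_nhds (show 0 < g / p by positivity)),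
      eventually_gt_atTop 0] with S hS hS0
    refine le_of_eq_of_le ?_ hS
    rw [Real.rpow_add hS0, Real.rpow_one, neg_mul]
    ring
  filter_upwards [eventually_ge_atTop 1, htail, eventually_source_bounds (m := m) hp hc₀ hk0 hg0,
    eventually_le_mul_self hg0 (-Real.log (1 / 4)), eventually_le_mul_self hg0 (Real.log 3),
    eventually_ge_atTop (8 * A), eventually_le_mul_self hk0 (τ₀ ^ p),
    eventually_le_mul_self hk0 200, eventually_le_mul_self hg0 1]
    with S hS1 hRS hsrc hlog4 hlog3 hAS hτS hKS hgS
  intro σ μ u v q h hμ hμS hσ hσS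
  have hS : 0 < S := by linarith
  have hkS : 0 < k * S := by positivity
  have hμ1 : 1 ≤ μ := by
    by_contra! hcon
    have := Real.rpow_lt_one hμ.le hcon hp0
    linarith
  set t : ℝ := (1 / 2 + g) * S with ht
  have hηS : η * S ≤ 1 / 8 * S := by gcongr
  have hηS0 : 0 < η * S := by positivity
  have hgη : 100 * (g * S) = η * S := by rw [hg]; ring
  have htS : t ≤ S := by linarith
  have hσt : σ ≤ t := by linarith
  have hut := h.u_pos t hσt
  set R : ℝ := (B + c₀ * (τ₀ ^ m + S ^ (m / p))) * Real.exp (-(2 * g * S)) with hR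
  have hR0 : 0 ≤ R := by positivity
  have hRg : R ≤ g / p := (le_mul_of_one_le_left hR0 hS1).trans hRS
  obtain ⟨hvt, hμt⟩ := h.tail_bounds hσt (fun x hx =>
    h.source_tail_le hp hc₀ hτ₀ hB (hσt.trans hx))
  have hQR : (B + c₀ * (τ₀ ^ m + μ ^ m) * Real.exp (μ ^ p)) * Real.exp (-2 * t) ≤ R := by
    have e1 : μ ^ m = S ^ (m / p) := by
      rw [← hμS, ← Real.rpow_mul hμ.le]
      congr 1
      field_simp
    have e2 : Real.exp (-2 * t) = Real.exp (-S) * Real.exp (-(2 * g * S)) := by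
      rw [← Real.exp_add]
      congr 1
      rw [ht]; ring
    have e3 : Real.exp S * Real.exp (-S) = 1 := by rw [← Real.exp_add]; simp
    have e4 : B * Real.exp (-S) ≤ B := mul_le_of_le_one_right hB (by simpa using hS.le)
    rw [e1, e2, hμS, hR, ← mul_assoc]
    gcongr
    calc _ = B * Real.exp (-S) + c₀ * (τ₀ ^ m + S ^ (m / p)) * (Real.exp S * Real.exp (-S)) := by
          ring
      _ ≤ _ := by rw [e3]; linarith
  have hvR : v t ≤ R / 2 := by linarith
  have huR : μ - R / 4 ≤ u t := by linarith
  have hg1 : g ≤ 1 / 100 := by linarith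
  have hgp : g / p ≤ 1 / 100 := (div_le_self hg0.le (by linarith)).trans hg1
  have hu_lower : (1 - g / p) * μ ≤ u t := by
    have : g / p ≤ g / p * μ := le_mul_of_one_le_right (by positivity) hμ1
    linarith
  have hu_half : μ / 2 ≤ u t := by
    have : g / p * μ ≤ 1 / 100 * μ := by gcongr
    linarith
  have hut_pow : (1 - g) * S ≤ u t ^ p := by
    have e1 := one_add_mul_self_le_rpow_one_add (s := -(g / p)) (by linarith) (p := p) (by linarith)
    have e2 : 1 + p * -(g / p) = 1 - g := by field_simp; ring
    have e3 : ((1 - g / p) * μ) ^ p = (1 + -(g / p)) ^ p * S := by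
      rw [Real.mul_rpow (by linarith) hμ.le, hμS, sub_eq_add_neg]
    rw [e2] at e1
    calc (1 - g) * S ≤ (1 + -(g / p)) ^ p * S := by gcongr
      _ = ((1 - g / p) * μ) ^ p := e3.symm
      _ ≤ u t ^ p := Real.rpow_le_rpow (mul_nonneg (by linarith) hμ.le) hu_lower hp0.le
  have hX_le : ∀ s, σ ≤ s → u s ^ p ≤ S := fun s hs =>
    hμS ▸ Real.rpow_le_rpow (h.u_pos s hs).le (h.u_le hs) hp0.le
  have hψt : powSlope p u v t - 2 ≤ -1 := by
    have hvt0 := h.v_nonneg hσt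
    have e1 : u t ^ p / u t ≤ 2 * S := by
      rw [div_le_iff₀ hut]
      have := hX_le t hσt
      nlinarith
    have e2 : powSlope p u v t = p * (u t ^ p / u t) * v t := by unfold powSlope; ring
    have e3 : p * (u t ^ p / u t) * v t ≤ p * (2 * S) * (R / 2) := by gcongr
    have e4 : p * (2 * S) * (R / 2) = p * (S * R) := by ring
    have e5 : p * (S * R) ≤ p * (g / p) := by gcongr
    have e6 : p * (g / p) = g := by field_simp
    linarith
  have hlow : ∀ s ∈ Set.Icc (3 / 8 * S) t, k * S ≤ u s ^ p := by
    intro s hs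
    have hσs : σ ≤ s := by linarith [hs.1]
    have e1 := h.concave_le hσs hs.2
    have e2 : 1 / 4 * S * u t ≤ (s - σ) * u t := by
      have := hs.1
      gcongr
      linarith
    have e3 : (t - σ) * u s ≤ S * u s := by
      have := (h.u_pos s hσs).le
      gcongr
      linarith
    have e4 : 1 / 4 * u t ≤ u s := by
      refine le_of_mul_le_mul_left ?_ hS
      linarith
    calc k * S = (1 / 8 * μ) ^ p := by rw [hk, Real.mul_rpow (by norm_num) hμ.le, hμS]
      _ ≤ u s ^ p := Real.rpow_le_rpow (by positivity) (by linarith) hp0.le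
  have hreg : RegularOn p m c₀ τ₀ σ (k * S) u v (t - η * S) t := by
    intro s hs
    have hs' : s ∈ Set.Icc (3 / 8 * S) t := ⟨by linarith [hs.1], hs.2⟩
    have hσs : σ ≤ s := by linarith [hs'.1]
    have hτu : τ₀ ≤ u s :=
      (Real.rpow_le_rpow_iff hτ₀.le (h.u_pos s hσs).le hp0).1 (hτS.trans (hlow s hs'))
    obtain ⟨e1, e2⟩ := hbd σ μ u v q h s (by linarith [hs'.1]) hτu
    exact ⟨hσs, hτu, hlow s hs', by linarith, e2⟩
  have hbounds : ∀ s ∈ Set.Icc (t - η * S) t, Real.exp (phase p u s - g * S) ≤ source p m c₀ u s ∧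
      source p m c₀ u s ≤ Real.exp (phase p u s + g * S) := by
    intro s hs
    have hσs := (hreg s hs).1
    exact hsrc u s (h.u_pos s hσs) (hreg s hs).2.2.1 ((hX_le s hσs).trans (by linarith))
  have hamem : t - η * S ∈ Set.Icc (t - η * S) t := ⟨le_rfl, by linarith⟩
  obtain ⟨s, hs1, hs2, hs3, hs4⟩ := h.exists_peak_of_descending hp hc₀ (b := 1) hamem.2 hkS hreg
    one_pos hψt
    (by
      have : CE / (k * S) * (t - (t - η * S)) = CE / k * η := by field_simp; ring
      rw [this]
      calc CE / k * η ≤ CE / k * (k / (4 * CE)) := by gcongr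
        _ = 1 ^ 2 / 4 := by field_simp)
    (by rw [div_le_iff₀ hkS]; linarith)
    (by
      have e1 := (hbounds _ hamem).1.trans (hreg _ hamem).2.2.2.2
      rw [← Real.le_log_iff_exp_le (by norm_num)] at e1
      have e2 : -(3 * (g * S)) ≤ phase p u t := by
        unfold phase
        linarith
      linarith)
  have hsmem : s ∈ Set.Icc (t - η * S) t := ⟨hs1, hs2.le⟩
  refine ⟨s, by linarith, hs3, by linarith, ?_⟩
  have e1 : (1:ℝ) / 4 ≤ Real.exp (phase p u s + g * S) := by
    linarith [(hbounds s hsmem).2]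
  rw [← Real.log_le_iff_le_exp (by norm_num)] at e1
  unfold phase at e1
  linarith

end LogSol

/-- A strong peak of the source lies above every logarithmically corrected profile with a
sufficiently negative constant. -/
lemma exists_profile_lt_of_le_source {p m c₀ : ℝ} (hp : 2 < p) (hc₀ : 0 < c₀) {c : ℝ} (hc : 0 < c) :
    ∃ L : ℝ, ∀ᶠ S : ℝ in atTop, ∀ u : ℝ → ℝ, 0 < u S → S ≤ u S ^ p → source p m c₀ u S ≤ 3 →
      c ≤ source p m c₀ u S →
        (2 * S - (1 - (1 - m) / p) * Real.log (2 * S) + L) ^ (1 / p) < u S := by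
  have hp0 : 0 < p := by linarith
  set α : ℝ := 1 - (1 - m) / p with hα
  set L : ℝ := Real.log c - Real.log (c₀ * p) - |α| * Real.log 2 - 1 with hL
  refine ⟨L, ?_⟩
  have hlog : ∀ᶠ S : ℝ in atTop, 0 ≤ 2 * S - α * Real.log (2 * S) + L := by
    have h2 : Tendsto (fun S : ℝ => 2 * S) atTop atTop :=
      tendsto_id.const_mul_atTop two_pos
    have h1 := (Real.isLittleO_log_id_atTop.comp_tendsto h2).bound
      (show 0 < 1 / (2 * (|α| + 1)) by positivity)
    filter_upwards [h1, eventually_gt_atTop 0, eventually_ge_atTop (-L)] with S h3 hS hSL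
    simp only [Function.comp, id, Real.norm_eq_abs, abs_of_pos (show 0 < 2 * S by linarith)] at h3
    have h4 : |α * Real.log (2 * S)| ≤ S := by
      rw [abs_mul]
      calc |α| * |Real.log (2 * S)| ≤ (|α| + 1) * (1 / (2 * (|α| + 1)) * (2 * S)) := by
            gcongr; linarith
        _ = S := by field_simp
    have := le_abs_self (α * Real.log (2 * S))
    linarith
  filter_upwards [hlog, eventually_gt_atTop 0,
    eventually_rpow_le_of_source_le (p := p) (m := m) hp hc₀] with S h0 hS h3 u hu hSu hs3 hcs
  have hX := h3 u hu hs3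
  have hXpos : 0 < u S ^ p := by positivity
  have hα' : (m + p - 1) / p = α := by rw [hα]; field_simp; ring
  have hsrc : Real.log (source p m c₀ u S)
      = Real.log (c₀ * p) + α * Real.log (u S ^ p) + (u S ^ p - 2 * S) := by
    have : source p m c₀ u S
        = c₀ * p * (u S ^ p) ^ ((m + p - 1) / p) * Real.exp (u S ^ p - 2 * S) := by
      rw [← rpow_mul_rpow_div_eq hp hu]; unfold source; ring
    rw [this, Real.log_mul (by positivity) (by positivity), Real.log_mul (by positivity)
      (by positivity), Real.log_exp, Real.log_rpow hXpos, hα']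
  have h5 := Real.log_le_log hc hcs
  have h6 : |Real.log (u S ^ p) - Real.log (2 * S)| ≤ Real.log 2 := by
    rw [abs_le]
    constructor
    · have := Real.log_le_log (by linarith) (show 2 * S ≤ 2 * u S ^ p by linarith)
      rw [Real.log_mul (x := 2) (y := u S ^ p) (by norm_num) hXpos.ne'] at this
      linarith
    · have := Real.log_le_log hXpos (show u S ^ p ≤ 2 * (2 * S) by linarith)
      rw [Real.log_mul (x := 2) (y := 2 * S) (by norm_num) (by positivity)] at this
      linarith
  have h7 : α * (Real.log (u S ^ p) - Real.log (2 * S)) ≤ |α| * Real.log 2 :=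
    (le_abs_self _).trans (by rw [abs_mul]; gcongr)
  have h8 : 2 * S - α * Real.log (2 * S) + L < u S ^ p := by
    rw [hsrc] at h5
    linarith
  calc _ < (u S ^ p) ^ (1 / p) := Real.rpow_lt_rpow h0 h8 (by positivity)
    _ = u S := by rw [one_div, Real.rpow_rpow_inv hu.le hp0.ne']

/-- Solutions with large limit cross any comparison function that is asymptotically sandwiched
between `((2 - ε) s)^(1/p)` and the logarithmically corrected profiles arbitrarily often. -/
theorem LogSol.exists_zeros (p m c₀ τ₀ B : ℝ) (hp : 2 < p) (hc₀ : 0 < c₀) (hτ₀ : 0 < τ₀)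
    (hB : 0 ≤ B) {g : ℝ → ℝ} (hgcont : ∀ᶠ s in atTop, ContinuousAt g s)
    (hglow : ∀ ε ∈ Set.Ioo (0 : ℝ) 2, ∀ᶠ s in atTop, ((2 - ε) * s) ^ (1 / p) ≤ g s)
    (hgup : ∀ L : ℝ, ∀ᶠ s in atTop,
      g s ≤ (2 * s - (1 - (1 - m) / p) * Real.log (2 * s) + L) ^ (1 / p)) (N : ℕ) :
    ∃ c l : ℝ, 0 < c ∧ c ≤ 1 ∧ 0 < l ∧ ∀ᶠ M : ℝ in atTop,
      ∀ (σ μ : ℝ) (u v q : ℝ → ℝ), LogSol p m c₀ τ₀ B σ μ u v q → 0 < μ → μ ^ p = M → 0 ≤ σ →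
        σ ≤ l * M →
          ∃ S, l * M ≤ S ∧ powSlope p u v S = 2 ∧ c ≤ source p m c₀ u S ∧ S ≤ u S ^ p ∧
            ∃ Z : Finset ℝ, N ≤ Z.card ∧ ∀ z ∈ Z, S < z ∧ u z = g z := by
  have hp0 : 0 < p := by linarith
  induction N with
  | zero =>
    refine ⟨1 / 4, 1 / 8, by norm_num, by norm_num, by norm_num, ?_⟩
    filter_upwards [exists_first_peak p m c₀ τ₀ B hp hc₀ hτ₀ hB, eventually_gt_atTop 0]
      with M hM hM0 σ μ u v q h hμ hμM hσ hσM
    obtain ⟨s, h1, h2, h3, h4⟩ := hM σ μ u v q h hμ hμM hσ (by linarith)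
    exact ⟨s, by linarith, h2, h3, h4, ∅, by simp, by simp⟩
  | succ N ih =>
    obtain ⟨c, l, hc, hc1, hl, ih⟩ := ih
    obtain ⟨c', κ, c₁, hc', hc'1, hκ, hκ1, hc₁, hc₁2, hnext⟩ :=
      exists_next_peak p m c₀ τ₀ B hp hc₀ hτ₀ hc hc1
    obtain ⟨L, hL⟩ := exists_profile_lt_of_le_source (m := m) hp hc₀ hc
    obtain ⟨A, hA, hbd⟩ := exists_apriori_bounds p m c₀ τ₀ B hp hc₀ one_pos le_rfl
    obtain ⟨T, hT⟩ := eventually_atTop.1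
      ((hgcont.and (hglow c₁ ⟨hc₁, hc₁2⟩)).and (hgup L))
    obtain ⟨R, hR⟩ := eventually_atTop.1 ((hnext.and hL).and
      ((eventually_le_mul_self hκ (max T 0)).and ((eventually_ge_atTop (2 * A)).and
        (eventually_ge_atTop (max (τ₀ ^ p) T)))))
    refine ⟨c', κ / 2 * l, hc', hc'1, by positivity, ?_⟩
    filter_upwards [ih, eventually_le_mul_self hl R, eventually_gt_atTop 0]
      with M hM hMR hM0 σ μ u v q h hμ hμM hσ hσM
    have hlM : 0 < l * M := by positivity
    obtain ⟨S, hS1, hψ, hG, hSu, Z, hZ, hZz⟩ := hM σ μ u v q h hμ hμM hσ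
      (hσM.trans (by nlinarith [mul_lt_mul_of_pos_right hκ1 hlM]))
    obtain ⟨⟨hnS, hLS⟩, hκT, hAS, hτT⟩ := hR S (hMR.trans hS1)
    have hS0 : 0 < S := hlM.trans_le hS1
    have hσS : σ ≤ κ / 2 * S := by linarith [mul_le_mul_of_nonneg_left hS1 hκ.le]
    have hκS : κ * S < S := mul_lt_of_lt_one_left hS0 hκ1
    have huS := h.u_pos S (by linarith)
    obtain ⟨s₁, s', h1, h2, h3, h4, h5, h6, h7⟩ := hnS σ μ u v q h hσ hσS hSu hψ hG
    have hτS : τ₀ ≤ u S :=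
      (Real.rpow_le_rpow_iff hτ₀.le huS.le hp0).1 (((le_max_left _ _).trans hτT).trans hSu)
    have hS3 := (hbd σ μ u v q h S (by linarith) hτS).2
    have hup := hLS u huS hSu hS3 hG
    have hTS : T ≤ S := (le_max_right _ _).trans hτT
    have hTs : T ≤ s₁ := by linarith [le_max_left T 0]
    have hs₁0 : 0 < s₁ := by linarith [le_max_right T 0]
    have hσs₁ : σ ≤ s₁ := by linarith [mul_pos hκ hS0]
    have hus := h.u_pos s₁ hσs₁
    have hgs := (hT s₁ hTs).1.2
    have hgS := (hT S hTS).2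
    have hlow : u s₁ ≤ g s₁ := by
      refine le_trans ?_ hgs
      rw [one_div]
      refine (Real.le_rpow_inv_iff_of_pos hus.le (mul_nonneg (by linarith) hs₁0.le) hp0).2 ?_
      have := mul_le_mul_of_nonneg_left h3.le hc₁.le
      unfold phase at h4
      linarith
    have hcont : ContinuousOn (fun x => u x - g x) (Set.Icc s₁ S) := fun x hx =>
      ((h.hu x (hσs₁.trans hx.1)).continuousAt.sub
        (hT x (hTs.trans hx.1)).1.1).continuousWithinAt
    obtain ⟨z, hz, hz0⟩ := intermediate_value_Icc h3.le hcont
      (show (0 : ℝ) ∈ Set.Icc (u s₁ - g s₁) (u S - g S) from ⟨by linarith, by linarith⟩)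
    have hzS : z ≠ S := by
      rintro rfl
      simp only at hz0
      linarith
    have hzlt : z < S := lt_of_le_of_ne hz.2 hzS
    refine ⟨s', by linarith [mul_le_mul_of_nonneg_left hS1 hκ.le, mul_pos hκ hS0], h5, h6, h7, insert z Z, ?_, ?_⟩
    · rw [Finset.card_insert_of_notMem fun hmem => by linarith [(hZz z hmem).1]]
      omega
    · intro y hy
      rcases Finset.mem_insert.1 hy with rfl | hy
      · exact ⟨by linarith [hz.1], by simp only at hz0; linarith⟩
      · exact ⟨by linarith [(hZz y hy).1], (hZz y hy).2⟩

/-- A radial solution in the plane becomes a `LogSol` after the substitution `r = exp (-s)`. -/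
lemma LogSol.of_radial {p m c₀ τ₀ B R σ : ℝ} {f U : ℝ → ℝ}
    (hC2 : ContDiffOn ℝ 2 U (Set.Icc 0 R)) (hpos : ∀ r ∈ Set.Ico (0 : ℝ) R, 0 < U r)
    (heq : ∀ r ∈ Set.Ioo (0 : ℝ) R, -(deriv (deriv U) r) - deriv U r / r = f (U r))
    (hf0 : ∀ t, 0 < t → 0 ≤ f t) (hfB : ∀ t, 0 < t → t ≤ τ₀ → f t ≤ B)
    (hfH : ∀ t, τ₀ ≤ t → f t = c₀ * t ^ m * Real.exp (t ^ p))
    (hσ : Real.exp (-σ) < R) :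
    LogSol p m c₀ τ₀ B σ (U 0) (fun s => U (Real.exp (-s)))
      (fun s => -(Real.exp (-s) * deriv U (Real.exp (-s))))
      (fun s => Real.exp (-2 * s) * f (U (Real.exp (-s)))) := by
  have hR : 0 < R := (Real.exp_pos _).trans hσ
  have hmem : ∀ s, σ ≤ s → Real.exp (-s) ∈ Set.Ioo 0 R := fun s hs =>
    ⟨Real.exp_pos _, (Real.exp_le_exp.2 (neg_le_neg hs)).trans_lt hσ⟩
  have hUpos : ∀ s, σ ≤ s → 0 < U (Real.exp (-s)) := fun s hs =>
    hpos _ ⟨(hmem s hs).1.le, (hmem s hs).2⟩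
  have hexp : ∀ s : ℝ, HasDerivAt (fun s : ℝ => Real.exp (-s)) (-Real.exp (-s)) s := fun s => by
    simpa using (hasDerivAt_neg s).exp
  have hsq : ∀ s : ℝ, Real.exp (-2 * s) = Real.exp (-s) * Real.exp (-s) := fun s => by
    rw [← Real.exp_add]; ring_nf
  have hat : ∀ r ∈ Set.Ioo 0 R, ContDiffAt ℝ 2 U r := fun r hr =>
    hC2.contDiffAt (Icc_mem_nhds hr.1 hr.2)
  have hU1 : ∀ r ∈ Set.Ioo 0 R, HasDerivAt U (deriv U r) r := fun r hr =>
    ((hat r hr).differentiableAt (by norm_num)).hasDerivAt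
  have hU2 : ∀ r ∈ Set.Ioo 0 R, HasDerivAt (deriv U) (deriv (deriv U) r) r := fun r hr => by
    have h1 : ContDiffOn ℝ 2 U (Set.Ioo 0 R) := hC2.mono Set.Ioo_subset_Icc_self
    have h2 : ContDiffOn ℝ 1 (deriv U) (Set.Ioo 0 R) :=
      h1.deriv_of_isOpen isOpen_Ioo (by norm_num)
    exact ((h2.contDiffAt (Ioo_mem_nhds hr.1 hr.2)).differentiableAt (by norm_num)).hasDerivAt
  have hlim : Tendsto (fun s : ℝ => Real.exp (-s)) atTop (nhds 0) :=
    Real.tendsto_exp_neg_atTop_nhds_zero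
  refine ⟨fun s hs => ?_, fun s hs => ?_, hUpos, fun s hs => ?_, fun s hs hτ => ?_,
    fun s hs hτ => ?_, ?_, ?_⟩
  · exact ((hU1 _ (hmem s hs)).comp s (hexp s)).congr_deriv (by ring)
  · have h1 := ((hexp s).mul ((hU2 _ (hmem s hs)).comp s (hexp s))).neg
    refine HasDerivAt.congr_deriv
      (f := fun s => -(Real.exp (-s) * deriv U (Real.exp (-s)))) h1 ?_
    rw [← heq _ (hmem s hs), hsq]
    simp only [Function.comp]
    field_simp [(Real.exp_pos (-s)).ne']
    ring
  · exact mul_nonneg (Real.exp_pos _).le (hf0 _ (hUpos s hs))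
  · rw [hfH _ hτ, sub_eq_add_neg, Real.exp_add]
    ring_nf
  · rw [mul_comm]
    exact mul_le_mul_of_nonneg_right (hfB _ (hUpos s hs) hτ) (Real.exp_pos _).le
  · have hcd : ContinuousOn (derivWithin U (Set.Icc 0 R)) (Set.Icc 0 R) :=
      hC2.continuousOn_derivWithin (uniqueDiffOn_Icc hR) (by norm_num)
    obtain ⟨C, hC⟩ := isCompact_Icc.exists_bound_of_continuousOn hcd
    refine squeeze_zero_norm' (a := fun s => Real.exp (-s) * C) ?_ (by simpa using hlim.mul_const C)
    filter_upwards [eventually_ge_atTop σ] with s hs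
    have hr := hmem s hs
    have := hC _ ⟨hr.1.le, hr.2.le⟩
    rw [derivWithin_of_mem_nhds (Icc_mem_nhds hr.1 hr.2)] at this
    rw [norm_neg, norm_mul, Real.norm_of_nonneg (Real.exp_pos _).le]
    gcongr
  · have h1 := hC2.continuousOn 0 ⟨le_rfl, hR.le⟩
    refine h1.tendsto.comp (tendsto_nhdsWithin_iff.2 ⟨hlim, ?_⟩)
    filter_upwards [eventually_ge_atTop σ] with s hs
    exact ⟨(hmem s hs).1.le, (hmem s hs).2.le⟩

/-- Corollary 5.8 of the paper, intersections for solutions of (q1). -/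
theorem statement17
    (p : ℝ) (hp : 2 < p)
    (h : ℝ → ℝ)
    (hhC1 : ContDiffOn ℝ 1 h (Set.Ici 0))
    (hhnonneg : ∀ t : ℝ, 0 ≤ t → 0 ≤ h t)
    (t₀' : ℝ) (ht₀' : 0 < t₀') (hhpos : ∀ t : ℝ, t₀' ≤ t → 0 < h t)
    (f : ℝ → ℝ) (hf : ∀ t : ℝ, f t = h t * Real.exp (t ^ p))
    -- (H3)
    (c₀ τ₀ m : ℝ) (hc₀ : 0 < c₀) (hτ₀ : 0 < τ₀)
    (hH3 : ∀ t : ℝ, τ₀ ≤ t → f t = c₀ * t ^ m * Real.exp (t ^ p))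
    -- solutions of problem (q1)
    (rbar μbar : ℕ → ℝ) (ubar : ℕ → ℝ → ℝ)
    (hrbar : ∀ n, 0 < rbar n) (hμbar : ∀ n, 0 < μbar n)
    (huC2 : ∀ n, ContDiffOn ℝ 2 (ubar n) (Set.Icc 0 (rbar n)))
    (hupos : ∀ n, ∀ r ∈ Set.Ico (0:ℝ) (rbar n), 0 < ubar n r)
    (hu0 : ∀ n, ubar n 0 = μbar n)
    (hu'0 : ∀ n, deriv (ubar n) 0 = 0)
    (hu1 : ∀ n, ubar n (rbar n) = 0)
    (heq : ∀ n, ∀ r ∈ Set.Ioo (0:ℝ) (rbar n),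
      -(deriv (deriv (ubar n)) r) - deriv (ubar n) r / r = f (ubar n r))
    (hmuInf : Tendsto μbar atTop atTop)
    -- the continuous singular comparison function Ū and the sandwich hypotheses
    (Ub : ℝ → ℝ) (r₁ : ℝ) (hr₁ : 0 < r₁) (hUcont : ContinuousOn Ub (Set.Ioo 0 r₁))
    (hUb : ∀ ε ∈ Set.Ioo (0:ℝ) 2, ∀ L : ℝ, ∃ r₀ ∈ Set.Ioo (0:ℝ) 1,
      ∀ r ∈ Set.Ioo (0:ℝ) r₀, Ubeta p (2 - ε) r ≤ Ub r ∧ Ub r ≤ Vfun p m L r) :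
    ∀ r : ℕ → ℝ, (∀ n, r n ∈ Set.Ioc 0 (rbar n)) →
      Tendsto (fun n => Real.log (1 / r n) / μbar n ^ p) atTop (nhds 0) →
      ∃ φ : ℕ → ℕ, StrictMono φ ∧
        ∀ N : ℕ, ∀ᶠ n in atTop,
          ZeroCountAtLeast (Set.Ioo 0 (r (φ n)))
            (fun x => ubar (φ n) x - Ub x) N := by
  intro r hr hrlim
  refine ⟨id, strictMono_id, fun N => ?_⟩
  have hp0 : 0 < p := by linarith
  have hf0 : ∀ t, 0 < t → 0 ≤ f t := fun t ht => by
    rw [hf]; exact mul_nonneg (hhnonneg t ht.le) (Real.exp_pos _).le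
  obtain ⟨B, hB0, hB⟩ : ∃ B, 0 ≤ B ∧ ∀ t, 0 < t → t ≤ τ₀ → f t ≤ B := by
    have hcont : ContinuousOn f (Set.Icc 0 τ₀) := by
      have hrpow : Continuous fun t : ℝ => Real.exp (t ^ p) :=
        Real.continuous_exp.comp (Real.continuous_rpow_const hp0.le)
      exact ((hhC1.continuousOn.mono Set.Icc_subset_Ici_self).mul hrpow.continuousOn).congr
        fun t _ => hf t
    obtain ⟨C, hC⟩ := isCompact_Icc.exists_bound_of_continuousOn hcont
    exact ⟨C, (norm_nonneg _).trans (hC 0 ⟨le_rfl, hτ₀.le⟩),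
      fun t h0 h1 => (Real.le_norm_self _).trans (hC t ⟨h0.le, h1⟩)⟩
  have hsmall : ∀ ρ : ℝ, 0 < ρ → ∀ᶠ s : ℝ in atTop, Real.exp (-s) ∈ Set.Ioo 0 ρ := fun ρ hρ => by
    filter_upwards [Real.tendsto_exp_neg_atTop_nhds_zero.eventually (gt_mem_nhds hρ)] with s hs
    exact ⟨Real.exp_pos _, hs⟩
  have hlog : ∀ s : ℝ, Real.log (1 / Real.exp (-s)) = s := fun s => by simp
  obtain ⟨c, l, -, -, hl, hmain⟩ := LogSol.exists_zeros p m c₀ τ₀ B hp hc₀ hτ₀ hB0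
    (g := fun s => Ub (Real.exp (-s)))
    (by
      filter_upwards [hsmall r₁ hr₁] with s hs
      exact ContinuousAt.comp (f := fun s : ℝ => Real.exp (-s))
        (hUcont.continuousAt (Ioo_mem_nhds hs.1 hs.2)) (by fun_prop))
    (fun ε hε => by
      obtain ⟨r₀, hr₀, hr₀'⟩ := hUb ε hε 0
      filter_upwards [hsmall r₀ hr₀.1] with s hs
      have := (hr₀' _ hs).1
      rwa [Ubeta, hlog] at this)
    (fun L => by
      obtain ⟨r₀, hr₀, hr₀'⟩ := hUb 1 (by norm_num) L
      filter_upwards [hsmall r₀ hr₀.1] with s hs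
      have := (hr₀' _ hs).2
      rwa [Vfun, hlog] at this) N
  have hμp : Tendsto (fun n => μbar n ^ p) atTop atTop := (tendsto_rpow_atTop hp0).comp hmuInf
  filter_upwards [hμp.eventually hmain, hμp.eventually (eventually_ge_atTop (2 / l)),
    hrlim.eventually (gt_mem_nhds (half_pos hl))] with n hn hMl hrn
  have hM0 : 0 < μbar n ^ p := Real.rpow_pos_of_pos (hμbar n) p
  rw [div_lt_iff₀ hM0] at hrn
  rw [div_le_iff₀ hl] at hMl
  have hrpos := (hr n).1
  set σ : ℝ := max 0 (Real.log (1 / r n) + 1)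
  have hexpr : Real.exp (-σ) < r n := by
    rw [← Real.lt_log_iff_exp_lt hrpos]
    have h1 : Real.log (1 / r n) + 1 ≤ σ := le_max_right _ _
    have h2 : Real.log (1 / r n) = -Real.log (r n) := by rw [one_div, Real.log_inv]
    linarith
  have hsol := LogSol.of_radial (p := p) (m := m) (c₀ := c₀) (σ := σ) (huC2 n) (hupos n) (heq n)
    hf0 hB hH3 (hexpr.trans_le (hr n).2)
  rw [hu0] at hsol
  have hσM : σ ≤ l * μbar n ^ p := max_le (by positivity) (by linarith)
  obtain ⟨S, hS, -, -, -, Z, hZ, hZz⟩ := hn σ _ _ _ _ hsol (hμbar n) rfl (le_max_left _ _) hσM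
  refine ⟨Z.image fun s => Real.exp (-s), ?_, ?_⟩
  · intro x hx
    obtain ⟨z, hz, rfl⟩ := Finset.mem_image.1 (Finset.mem_coe.1 hx)
    obtain ⟨h1, h2⟩ := hZz z hz
    refine ⟨⟨Real.exp_pos _, lt_of_le_of_lt (Real.exp_le_exp.2 ?_) hexpr⟩, sub_eq_zero.2 h2⟩
    linarith
  · rwa [Finset.card_image_of_injective (f := fun s => Real.exp (-s)) _
      (Real.exp_injective.comp neg_injective)]
end

section
/- Assume (H4). Then there exists a value R̄* > exp(−τ₀^p/2) and a C² function Ū* on (0, R̄*] such that Ū*(r) = (2·log(1/r))^{1/p} for all r ∈ (0, exp(−τ₀^p/2)], Ū* > 0 and strictly decreasing on (0, R̄*), Ū*(R̄*) = 0, lim_{r→0⁺} Ū*(r) = ∞, and −(Ū*)''(r) − (Ū*)'(r)/r = f(Ū*(r)) for all r ∈ (0, R̄*). -/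
open Filter

open Set

open scoped NNReal

/-- A function of class `C¹` on `[0, ∞)` becomes globally Lipschitz and bounded once its argument
is clamped to `[0, τ]`. -/
lemma exists_lipschitz_clamp {f : ℝ → ℝ} (hf : ContDiffOn ℝ 1 f (Ici 0)) {τ : ℝ} (hτ : 0 ≤ τ) :
    ∃ (K : ℝ≥0) (M : ℝ), LipschitzWith K (fun t => f (max 0 (min t τ))) ∧
      ∀ t, f (max 0 (min t τ)) ≤ M := by
  have hloc : LocallyLipschitzOn (Ici 0) f := fun x hx =>
    (hf x hx).exists_lipschitzOnWith (convex_Ici 0)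
  obtain ⟨K, hK⟩ := (hloc.mono (s := Icc 0 τ) Icc_subset_Ici_self).exists_lipschitzOnWith_of_compact
    isCompact_Icc
  have hmem : ∀ t : ℝ, max 0 (min t τ) ∈ Icc 0 τ := fun t =>
    ⟨le_max_left _ _, max_le hτ (min_le_right _ _)⟩
  have hclamp : LipschitzWith 1 (fun t : ℝ => max 0 (min t τ)) :=
    (LipschitzWith.id.min_const τ).const_max 0
  obtain ⟨M, hM⟩ := isCompact_Icc.bddAbove_image hK.continuousOn
  refine ⟨K, M, ?_, fun t => hM ⟨_, hmem t, rfl⟩⟩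
  have := hK.comp (hclamp.lipschitzOnWith (s := univ)) (fun t _ => hmem t)
  simpa [Function.comp_def] using this

/-- Backward solvability of `w'' = -q(t) g(w)` on a compact interval, for a bounded nonnegative
Lipschitz function `g`; the slope of the solution is at least its terminal value. -/
lemma exists_backward_solution {q g : ℝ → ℝ} {a b : ℝ} (hab : a ≤ b) {K : ℝ≥0} {M : ℝ}
    (hq : ContinuousOn q (Icc a b)) (hq0 : ∀ t ∈ Icc a b, 0 ≤ q t)
    (hg : LipschitzWith K g) (hg0 : ∀ x, 0 ≤ g x) (hgM : ∀ x, g x ≤ M) (c v₀ : ℝ) :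
    ∃ w v : ℝ → ℝ, w b = c ∧ v b = v₀ ∧ ∀ t ∈ Icc a b,
      HasDerivWithinAt w (v t) (Icc a b) t ∧
      HasDerivWithinAt v (-(q t * g (w t))) (Icc a b) t ∧ v₀ ≤ v t := by
  obtain ⟨Q, hQ⟩ := isCompact_Icc.bddAbove_image hq
  replace hQ : ∀ t ∈ Icc a b, q t ≤ Q := fun t ht => hQ ⟨t, ht, rfl⟩
  have hQ0 : 0 ≤ Q := (hq0 a ⟨le_rfl, hab⟩).trans (hQ a ⟨le_rfl, hab⟩)
  have hM0 : 0 ≤ M := (hg0 0).trans (hgM 0)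
  have hqg : ∀ t ∈ Icc a b, ∀ x, q t * g x ≤ Q * M := fun t ht x =>
    mul_le_mul (hQ t ht) (hgM x) (hg0 x) hQ0
  set v₁ : ℝ := v₀ + Q * M * (b - a) with hv₁
  have hv : v₀ ≤ v₁ := by
    have : 0 ≤ Q * M * (b - a) := by have := sub_nonneg.2 hab; positivity
    linarith
  let F : ℝ → ℝ × ℝ → ℝ × ℝ := fun t x => (max v₀ (min x.2 v₁), -(q t * g x.1))
  let L : ℝ≥0 := ⟨max (|v₀| + |v₁|) (Q * M), by positivity⟩
  let R : ℝ≥0 := L * ⟨b - a, sub_nonneg.2 hab⟩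
  have hPL : IsPicardLindelof F (⟨b, hab, le_rfl⟩ : Icc a b) (c, v₀) R 0 L
      (max 1 (⟨Q, hQ0⟩ * K)) := by
    refine ⟨fun t ht => ?_, fun x _ => ?_, fun t ht x _ => ?_, ?_⟩
    · apply LipschitzWith.lipschitzOnWith
      apply LipschitzWith.prodMk
      · exact (LipschitzWith.prod_snd.min_const v₁).const_max v₀
      · refine LipschitzWith.of_dist_le_mul fun x y => ?_
        have h1 : dist (g x.1) (g y.1) ≤ K * dist x y :=
          (hg.dist_le_mul _ _).trans
            (mul_le_mul_of_nonneg_left (by rw [Prod.dist_eq]; exact le_max_left _ _) K.2)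
        rw [dist_neg_neg, Real.dist_eq, ← mul_sub, abs_mul, abs_of_nonneg (hq0 t ht),
          ← Real.dist_eq]
        calc q t * dist (g x.1) (g y.1) ≤ Q * (K * dist x y) :=
              mul_le_mul (hQ t ht) h1 dist_nonneg hQ0
          _ = _ := by
              rw [← mul_assoc]; rfl
    · exact continuousOn_const.prodMk (hq.mul continuousOn_const).neg
    · refine (Prod.norm_def _).trans_le (max_le_max ?_ ?_)
      · have h1 : v₀ ≤ max v₀ (min x.2 v₁) := le_max_left _ _
        have h2 : max v₀ (min x.2 v₁) ≤ v₁ := max_le hv (min_le_right _ _)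
        rw [Real.norm_eq_abs, abs_le]
        constructor <;> linarith [neg_abs_le v₀, le_abs_self v₁, abs_nonneg v₀, abs_nonneg v₁]
      · rw [norm_neg, Real.norm_of_nonneg (mul_nonneg (hq0 t ht) (hg0 _))]
        exact hqg t ht _
    · have hm : max (b - b) (b - a) = b - a := max_eq_right (by linarith)
      simp only [hm, NNReal.coe_zero, sub_zero]
      exact le_rfl
  obtain ⟨y, hyb, hy⟩ := hPL.exists_eq_forall_mem_Icc_hasDerivWithinAt₀
  have hw : ∀ t ∈ Icc a b,
      HasDerivWithinAt (fun t => (y t).1) (max v₀ (min (y t).2 v₁)) (Icc a b) t :=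
    fun t ht => (hy t ht).fst
  have hvd : ∀ t ∈ Icc a b,
      HasDerivWithinAt (fun t => (y t).2) (-(q t * g (y t).1)) (Icc a b) t :=
    fun t ht => (hy t ht).snd
  have hb : b ∈ Icc a b := ⟨hab, le_rfl⟩
  have hyb2 : (y b).2 = v₀ := by simpa using congrArg Prod.snd hyb
  have hderiv : ∀ t ∈ interior (Icc a b),
      HasDerivAt (fun t => (y t).2) (-(q t * g (y t).1)) t := fun t ht =>
    (hvd t (interior_subset ht)).hasDerivAt (mem_interior_iff_mem_nhds.1 ht)
  have hvc : ContinuousOn (fun t => (y t).2) (Icc a b) := fun t ht => (hvd t ht).continuousWithinAt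
  have hanti : AntitoneOn (fun t => (y t).2) (Icc a b) := by
    refine antitoneOn_of_deriv_nonpos (convex_Icc a b) hvc
      (fun t ht => (hderiv t ht).differentiableAt.differentiableWithinAt) fun t ht => ?_
    rw [(hderiv t ht).deriv, neg_nonpos]
    exact mul_nonneg (hq0 t (interior_subset ht)) (hg0 _)
  have hmono : MonotoneOn (fun t => (y t).2 + Q * M * t) (Icc a b) := by
    have hd : ∀ t ∈ interior (Icc a b),
        HasDerivAt (fun t => (y t).2 + Q * M * t) (-(q t * g (y t).1) + Q * M * 1) t :=
      fun t ht => (hderiv t ht).add ((hasDerivAt_id t).const_mul _)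
    refine monotoneOn_of_deriv_nonneg (convex_Icc a b)
      (hvc.add (continuousOn_const.mul continuousOn_id))
      (fun t ht => (hd t ht).differentiableAt.differentiableWithinAt) fun t ht => ?_
    rw [(hd t ht).deriv]
    linarith [hqg t (interior_subset ht) (y t).1]
  refine ⟨fun t => (y t).1, fun t => (y t).2, by simpa using congrArg Prod.fst hyb, hyb2,
    fun t ht => ?_⟩
  have h0 : v₀ ≤ (y t).2 := hyb2 ▸ hanti ht hb ht.2
  have h1 : (y t).2 ≤ v₁ := by
    have h2 := hmono ht hb ht.2
    simp only [hyb2] at h2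
    have h3 : Q * M * (b - t) ≤ Q * M * (b - a) :=
      mul_le_mul_of_nonneg_left (by linarith [ht.1]) (by positivity)
    rw [hv₁]
    linarith
  refine ⟨?_, hvd t ht, h0⟩
  have := hw t ht
  rwa [min_eq_left h1, max_eq_right h0] at this

/-- Gluing two differentiable functions whose values and derivatives agree at a point. -/
lemma hasDerivAt_ite_le {f g f' g' : ℝ → ℝ} {l a : ℝ} (h : f a = g a) (h' : f' a = g' a)
    (hl : ∀ x ∈ Icc l a, HasDerivWithinAt f (f' x) (Icc l a) x)
    (hr : ∀ x, a ≤ x → HasDerivAt g (g' x) x) {x : ℝ} (hx : l < x) :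
    HasDerivAt (fun x => if x ≤ a then f x else g x) (if x ≤ a then f' x else g' x) x := by
  rcases lt_trichotomy x a with hxa | rfl | hxa
  · rw [if_pos hxa.le]
    refine ((hl x ⟨hx.le, hxa.le⟩).hasDerivAt (Icc_mem_nhds hx hxa)).congr_of_eventuallyEq ?_
    filter_upwards [Iio_mem_nhds hxa] with y hy
    exact if_pos (le_of_lt hy)
  · rw [if_pos le_rfl]
    have h1 : HasDerivWithinAt (fun y => if y ≤ x then f y else g y) (f' x) (Icc l x) x :=
      (hl x ⟨hx.le, le_rfl⟩).congr (fun y hy => if_pos hy.2) (if_pos le_rfl)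
    have h2 : HasDerivWithinAt (fun y => if y ≤ x then f y else g y) (f' x) (Ici x) x := by
      rw [h']
      refine (hr x le_rfl).hasDerivWithinAt.congr (fun y hy => ?_) (by simp [h])
      rcases eq_or_lt_of_le (mem_Ici.1 hy) with rfl | hy
      · simp [h]
      · exact if_neg (not_le.2 hy)
    refine (h1.union h2).hasDerivAt ?_
    rw [Icc_union_Ici_eq_Ici hx.le]
    exact Ici_mem_nhds hx
  · rw [if_neg (not_le.2 hxa)]
    refine (hr x hxa.le).congr_of_eventuallyEq ?_
    filter_upwards [Ioi_mem_nhds hxa] with y hy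
    exact if_neg (not_le.2 hy)

lemma hasDerivAt_two_mul_rpow (α : ℝ) {s : ℝ} (hs : 0 < s) :
    HasDerivAt (fun s : ℝ => (2 * s) ^ α) (2 * α * (2 * s) ^ (α - 1)) s := by
  simpa using ((hasDerivAt_id s).const_mul 2).rpow_const (p := α) (Or.inl (by simp [hs.ne']))

/-- The singular solution in the variable `s = log (1 / r)`, in which the radial equation reads
`W'' = -exp (-2 s) f(W)`. -/
lemma exists_singular_solution_log
    {p : ℝ} (hp : 2 < p) {f : ℝ → ℝ} (hfC2 : ContDiffOn ℝ 2 f (Ici 0))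
    (hfnonneg : ∀ t : ℝ, 0 ≤ t → 0 ≤ f t) {τ₀ : ℝ} (hτ₀ : 0 < τ₀)
    (hH4 : ∀ t : ℝ, τ₀ ≤ t →
      f t = 4 * (p - 1) / p ^ 2 * t ^ (1 - 2 * p) * Real.exp (t ^ p)) :
    ∃ (l σ : ℝ) (W V : ℝ → ℝ), l < σ ∧ σ < τ₀ ^ p / 2 ∧ W σ = 0 ∧
      (∀ s, τ₀ ^ p / 2 ≤ s → W s = (2 * s) ^ (1 / p)) ∧
      ∀ s, l < s → 0 < V s ∧ HasDerivAt W (V s) s ∧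
        HasDerivAt V (-(Real.exp (-2 * s) * f (max 0 (W s)))) s := by
  have hp0 : 0 < p := by linarith
  set s₀ : ℝ := τ₀ ^ p / 2 with hs₀
  have hs₀pos : 0 < s₀ := by positivity
  have hs₀τ : (2 * s₀) ^ (1 / p) = τ₀ := by
    rw [hs₀, mul_div_cancel₀ _ two_ne_zero, ← Real.rpow_mul hτ₀.le, mul_one_div_cancel hp0.ne',
      Real.rpow_one]
  set A : ℝ → ℝ := fun s => (2 * s) ^ (1 / p) with hA
  set B : ℝ → ℝ := fun s => 2 * (1 / p) * (2 * s) ^ (1 / p - 1) with hB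
  have hBpos : ∀ s, 0 < s → 0 < B s := fun s hs => by simp only [hB]; positivity
  have hAd : ∀ s, s₀ ≤ s → HasDerivAt A (B s) s := fun s hs =>
    hasDerivAt_two_mul_rpow _ (hs₀pos.trans_le hs)
  have hAge : ∀ s, s₀ ≤ s → τ₀ ≤ A s := fun s hs => by
    rw [← hs₀τ]
    exact Real.rpow_le_rpow (by positivity) (by linarith) (by positivity)
  have hBd : ∀ s, s₀ ≤ s →
      HasDerivAt B (-(Real.exp (-2 * s) * f (max 0 (A s)))) s := fun s hs => by
    have hs0 : 0 < 2 * s := by linarith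
    have hAp : A s ^ p = 2 * s := by
      simp only [hA]
      rw [← Real.rpow_mul hs0.le, one_div_mul_cancel hp0.ne', Real.rpow_one]
    have hAp' : A s ^ (1 - 2 * p) = (2 * s) ^ (1 / p - 1 - 1) := by
      simp only [hA]
      rw [← Real.rpow_mul hs0.le]
      congr 1
      field_simp
      ring
    refine ((hasDerivAt_two_mul_rpow (1 / p - 1) (hs₀pos.trans_le hs)).const_mul
      (2 * (1 / p))).congr_deriv (Eq.symm ?_)
    rw [max_eq_right (hτ₀.le.trans (hAge s hs)), hH4 _ (hAge s hs), hAp, hAp']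
    have he : Real.exp (-2 * s) * Real.exp (2 * s) = 1 := by
      rw [← Real.exp_add]; simp
    calc -(Real.exp (-2 * s) * (4 * (p - 1) / p ^ 2 * (2 * s) ^ (1 / p - 1 - 1)
            * Real.exp (2 * s)))
        = -(4 * (p - 1) / p ^ 2 * (2 * s) ^ (1 / p - 1 - 1))
            * (Real.exp (-2 * s) * Real.exp (2 * s)) := by ring
      _ = _ := by
        rw [he]
        field_simp
        ring
  obtain ⟨K, M, hK, hM⟩ := exists_lipschitz_clamp (hfC2.of_le (by norm_num)) hτ₀.le
  set l : ℝ := s₀ - (τ₀ / B s₀ + 1) with hl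
  have hB0 := hBpos s₀ hs₀pos
  have hτB : 0 < τ₀ / B s₀ := by positivity
  have hls : l < s₀ := by linarith
  obtain ⟨w, v, hws, hvs, hwv⟩ := exists_backward_solution (q := fun s => Real.exp (-2 * s)) hls.le
    (by fun_prop) (fun _ _ => (Real.exp_pos _).le) hK (fun x => hfnonneg _ (le_max_left _ _)) hM
    τ₀ (B s₀)
  have hwc : ContinuousOn w (Icc l s₀) := fun t ht => (hwv t ht).1.continuousWithinAt
  have hderiv : ∀ t ∈ interior (Icc l s₀), HasDerivAt w (v t) t := fun t ht =>
    (hwv t (interior_subset ht)).1.hasDerivAt (mem_interior_iff_mem_nhds.1 ht)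
  have hslope : ∀ t ∈ Icc l s₀, B s₀ * (s₀ - t) ≤ τ₀ - w t := fun t ht => by
    rw [← hws]
    refine (convex_Icc l s₀).mul_sub_le_image_sub_of_le_deriv hwc
      (fun t ht => (hderiv t ht).differentiableAt.differentiableWithinAt) (fun t ht => ?_)
      t ht s₀ ⟨hls.le, le_rfl⟩ ht.2
    rw [(hderiv t ht).deriv]
    exact (hwv t (interior_subset ht)).2.2
  have hwle : ∀ t ∈ Icc l s₀, w t ≤ τ₀ := fun t ht => by
    nlinarith [hslope t ht, ht.2]
  have hwl : w l < 0 := by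
    have h1 := hslope l ⟨le_rfl, hls.le⟩
    have h2 : B s₀ * (s₀ - l) = τ₀ + B s₀ := by
      rw [hl]
      field_simp
      ring
    linarith
  obtain ⟨σ, ⟨hσl, hσs⟩, hσ⟩ := intermediate_value_Ioo hls.le hwc
    (show (0 : ℝ) ∈ Ioo (w l) (w s₀) from ⟨hwl, by rw [hws]; exact hτ₀⟩)
  have hWA : w s₀ = A s₀ := hws.trans hs₀τ.symm
  refine ⟨l, σ, fun s => if s ≤ s₀ then w s else A s, fun s => if s ≤ s₀ then v s else B s,
    hσl, hσs, by simp [hσs.le, hσ], fun s hs => ?_, fun s hs => ⟨?_, ?_, ?_⟩⟩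
  · rcases eq_or_lt_of_le hs with rfl | hs
    · simp [hWA, hA]
    · exact if_neg (not_le.2 hs)
  · by_cases h : s ≤ s₀
    · simpa [h] using hB0.trans_le (hwv s ⟨hs.le, h⟩).2.2
    · simpa [h] using hBpos s (hs₀pos.trans (not_le.1 h))
  · exact hasDerivAt_ite_le hWA hvs (fun x hx => (hwv x hx).1) hAd hs
  · have h1 : ∀ x ∈ Icc l s₀, HasDerivWithinAt v
        ((fun x => -(Real.exp (-2 * x) * f (max 0 (w x)))) x) (Icc l s₀) x := fun x hx => by
      have := (hwv x hx).2.1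
      rwa [min_eq_left (hwle x hx)] at this
    have := hasDerivAt_ite_le (g := B) hvs
      (g' := fun s => -(Real.exp (-2 * s) * f (max 0 (A s)))) (by simp only [hWA]) h1 hBd hs
    refine this.congr_deriv ?_
    dsimp only
    split_ifs <;> rfl

/-- Lemma 5.9 of the paper, existence of a singular solution under
(H4). -/
theorem statement18
    (p : ℝ) (hp : 2 < p)
    (f : ℝ → ℝ)
    (hfC2 : ContDiffOn ℝ 2 f (Set.Ici 0))
    (hfnonneg : ∀ t : ℝ, 0 ≤ t → 0 ≤ f t)
    (t₁ : ℝ) (hfpos : ∀ t : ℝ, t₁ ≤ t → 0 < f t)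
    (τ₀ : ℝ) (hτ₀ : 0 < τ₀)
    (hH4 : ∀ t : ℝ, τ₀ ≤ t →
      f t = 4 * (p - 1) / p ^ 2 * t ^ (1 - 2 * p) * Real.exp (t ^ p)) :
    ∃ Rstar : ℝ, Real.exp (-(τ₀ ^ p) / 2) < Rstar ∧
      ∃ Ustar : ℝ → ℝ,
        ContDiffOn ℝ 2 Ustar (Set.Ioc 0 Rstar) ∧
        (∀ r ∈ Set.Ioc (0:ℝ) (Real.exp (-(τ₀ ^ p) / 2)),
          Ustar r = (2 * Real.log (1 / r)) ^ (1 / p)) ∧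
        (∀ r ∈ Set.Ioo (0:ℝ) Rstar, 0 < Ustar r) ∧
        StrictAntiOn Ustar (Set.Ioo 0 Rstar) ∧
        Ustar Rstar = 0 ∧
        Tendsto Ustar (nhdsWithin 0 (Set.Ioi 0)) atTop ∧
        (∀ r ∈ Set.Ioo (0:ℝ) Rstar,
          -(deriv (deriv Ustar) r) - deriv Ustar r / r = f (Ustar r)) := by
  obtain ⟨l, σ, W, V, hlσ, hσ, hWσ, hW, hWV⟩ :=
    exists_singular_solution_log hp hfC2 hfnonneg hτ₀ hH4
  have hp0 : 0 < p := by linarith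
  have hWd : ∀ s, l < s → HasDerivAt W (V s) s := fun s hs => (hWV s hs).2.1
  have hmono : StrictMonoOn W (Ioi l) := by
    refine strictMonoOn_of_deriv_pos (convex_Ioi l)
      (fun s hs => (hWd s hs).continuousAt.continuousWithinAt) fun s hs => ?_
    rw [interior_Ioi] at hs
    rw [(hWd s hs).deriv]
    exact (hWV s hs).1
  have hlog : ∀ r ∈ Ioo 0 (Real.exp (-l)), l < -Real.log r := fun r hr => by
    have := (Real.log_lt_iff_lt_exp hr.1).2 hr.2
    linarith
  have hlogσ : ∀ r ∈ Ioo 0 (Real.exp (-σ)), σ < -Real.log r := fun r hr => by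
    have := (Real.log_lt_iff_lt_exp hr.1).2 hr.2
    linarith
  have hlt : Real.exp (-σ) < Real.exp (-l) := Real.exp_lt_exp.2 (by linarith)
  have hnl : ∀ r : ℝ, 0 < r → HasDerivAt (fun r => -Real.log r) (-r⁻¹) r := fun r hr =>
    (Real.hasDerivAt_log hr.ne').neg
  have hUd : ∀ r ∈ Ioo 0 (Real.exp (-l)),
      HasDerivAt (fun r => W (-Real.log r)) (V (-Real.log r) * -r⁻¹) r := fun r hr =>
    (hWd _ (hlog r hr)).comp r (hnl r hr.1)
  have hexp : ∀ r : ℝ, 0 < r → Real.exp (-2 * -Real.log r) = r ^ 2 := fun r hr => by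
    rw [show -2 * -Real.log r = Real.log r + Real.log r by ring, Real.exp_add, Real.exp_log hr, sq]
  have hUdd : ∀ r ∈ Ioo 0 (Real.exp (-l)),
      HasDerivAt (fun r => V (-Real.log r) * -r⁻¹)
        (V (-Real.log r) * (r ^ 2)⁻¹ - f (max 0 (W (-Real.log r)))) r := fun r hr => by
    have h1 := ((hWV _ (hlog r hr)).2.2.comp r (hnl r hr.1)).mul (hasDerivAt_inv hr.1.ne').neg
    rw [hexp r hr.1] at h1
    refine h1.congr_deriv ?_
    have := hr.1.ne'
    simp only [Function.comp_apply, Pi.neg_apply]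
    field_simp
    ring
  have hderiv : EqOn (deriv fun r => W (-Real.log r)) (fun r => V (-Real.log r) * -r⁻¹)
      (Ioo 0 (Real.exp (-l))) := fun r hr => (hUd r hr).deriv
  have hderiv2 : ∀ r ∈ Ioo 0 (Real.exp (-l)), deriv (deriv fun r => W (-Real.log r)) r =
      V (-Real.log r) * (r ^ 2)⁻¹ - f (max 0 (W (-Real.log r))) := fun r hr => by
    rw [(hderiv.eventuallyEq_of_mem (isOpen_Ioo.mem_nhds hr)).deriv_eq, (hUdd r hr).deriv]
  have hsub : Ioo 0 (Real.exp (-σ)) ⊆ Ioo 0 (Real.exp (-l)) := Ioo_subset_Ioo_right hlt.le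
  have hpos : ∀ r ∈ Ioo 0 (Real.exp (-σ)), 0 < W (-Real.log r) := fun r hr => by
    rw [← hWσ]
    exact hmono hlσ (hlog r (hsub hr)) (hlogσ r hr)
  have hout : ∀ r ∈ Ioc (0 : ℝ) (Real.exp (-(τ₀ ^ p) / 2)),
      W (-Real.log r) = (2 * Real.log (1 / r)) ^ (1 / p) := fun r hr => by
    have := (Real.log_le_iff_le_exp hr.1).2 hr.2
    rw [hW _ (by linarith), one_div r, Real.log_inv]
  refine ⟨Real.exp (-σ), Real.exp_lt_exp.2 (by linarith), fun r => W (-Real.log r), ?_, hout,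
    hpos, ?_, by simp [hWσ], ?_, fun r hr => ?_⟩
  · refine ContDiffOn.mono (s := Ioo 0 (Real.exp (-l))) ?_
      fun r hr => ⟨hr.1, hr.2.trans_lt hlt⟩
    rw [show (2 : WithTop ℕ∞) = 1 + 1 from one_add_one_eq_two.symm,
      contDiffOn_succ_iff_deriv_of_isOpen isOpen_Ioo]
    refine ⟨fun r hr => (hUd r hr).differentiableAt.differentiableWithinAt, by simp, ?_⟩
    rw [show (1 : WithTop ℕ∞) = 0 + 1 from (zero_add 1).symm,
      contDiffOn_succ_iff_deriv_of_isOpen isOpen_Ioo]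
    refine ⟨fun r hr => ((hUdd r hr).differentiableAt.differentiableWithinAt).congr hderiv
      (hderiv hr), by simp, ?_⟩
    rw [contDiffOn_zero]
    refine ContinuousOn.congr ?_ hderiv2
    have hlogc : ContinuousOn (fun r => -Real.log r) (Ioo 0 (Real.exp (-l))) := fun r hr =>
      (hnl r hr.1).continuousAt.continuousWithinAt
    have hVc : ContinuousOn V (Ioi l) := fun s hs =>
      (hWV s hs).2.2.continuousAt.continuousWithinAt
    have hUc : ContinuousOn (fun r => W (-Real.log r)) (Ioo 0 (Real.exp (-l))) := fun r hr =>
      (hUd r hr).continuousAt.continuousWithinAt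
    refine ((hVc.comp hlogc hlog).mul
      ((continuousOn_id.pow 2).inv₀ fun r hr => pow_ne_zero 2 hr.1.ne')).sub ?_
    exact hfC2.continuousOn.comp ((continuous_const.max continuous_id).comp_continuousOn hUc)
      fun r _ => mem_Ici.2 (le_max_left _ _)
  · intro r hr r' hr' h
    exact hmono (hlog r' (hsub hr')) (hlog r (hsub hr))
      (neg_lt_neg (Real.log_lt_log hr.1 h))
  · have h1 : Tendsto (fun r => (2 * -Real.log r) ^ (1 / p)) (nhdsWithin 0 (Ioi 0)) atTop :=
      (tendsto_rpow_atTop (by positivity)).comp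
        ((tendsto_neg_atBot_atTop.comp Real.tendsto_log_nhdsGT_zero).const_mul_atTop two_pos)
    refine h1.congr' ?_
    filter_upwards [Ioc_mem_nhdsGT (Real.exp_pos (-(τ₀ ^ p) / 2))] with r hr
    rw [hout r hr, one_div r, Real.log_inv]
  · rw [hderiv2 r (hsub hr), hderiv (hsub hr), max_eq_right (hpos r hr).le]
    have := hr.1.ne'
    field_simp
    ring
end
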